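/- arXiv:2601.02142 — 4 statements merged into one kernel-verified Lean document; each statement's English description precedes it below -/
import Mathlib

section
/- Let 0 < α < 1 and let u ∈ L¹_{ψ,ω}(ℝ). Then the weighted Weyl fractional integral 𝔍^α_{ψ,ω}u(t) = (1/(Γ(α) ω(t))) ∫_{-∞}^t (ψ(t) − ψ(τ))^{α−1} ω(τ) u(τ) ψ'(τ) dτ converges absolutely for almost every t ∈ ℝ; that is, for almost every t ∈ ℝ one has ∫_{-∞}^t (ψ(t) − ψ(τ))^{α−1} |u(τ)| ω(τ) ψ'(τ) dτ < ∞. -/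
open MeasureTheory Set Filter

noncomputable section

/-- The part of the Riemann-Liouville kernel with its singularity, truncated to `(0, 1)`. -/
def truncatedKernel (α : ℝ) : ℝ → ENNReal :=
  (Ioo (0 : ℝ) 1).indicator fun s => ENNReal.ofReal (s ^ (α - 1))

theorem measurable_truncatedKernel (α : ℝ) : Measurable (truncatedKernel α) :=
  Measurable.indicator (by fun_prop) measurableSet_Ioo

theorem lintegral_truncatedKernel_lt_top {α : ℝ} (hα : 0 < α) :
    ∫⁻ s, truncatedKernel α s < ⊤ := by
  have h : IntegrableOn (fun s : ℝ => s ^ (α - 1)) (Ioo 0 1) := by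
    rw [intervalIntegral.integrableOn_Ioo_rpow_iff one_pos]
    linarith
  unfold truncatedKernel
  rw [lintegral_indicator measurableSet_Ioo]
  exact h.lintegral_lt_top

theorem lintegral_deriv_mul_comp_sub_le {ψ ψ' : ℝ → ℝ} (hψ : Function.Injective ψ)
    (hderiv : ∀ t, HasDerivAt ψ (ψ' t) t) (φ : ℝ → ENNReal) (a : ℝ) :
    ∫⁻ t, ENNReal.ofReal |ψ' t| * φ (ψ t - a) ≤ ∫⁻ s, φ s := by
  have h := lintegral_image_eq_lintegral_abs_deriv_mul MeasurableSet.univ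
    (fun t _ => (hderiv t).hasDerivWithinAt) hψ.injOn (fun s => φ (s - a))
  rw [Measure.restrict_univ] at h
  rw [← h, ← lintegral_sub_right_eq_self φ a]
  exact setLIntegral_le_lintegral _ _

theorem ae_lintegral_comp_sub_mul_lt_top {ψ ψ' : ℝ → ℝ} (hψ : Function.Injective ψ)
    (hderiv : ∀ t, HasDerivAt ψ (ψ' t) t) (hψ'meas : Measurable ψ') (hψ'ne : ∀ t, ψ' t ≠ 0)
    {φ G : ℝ → ENNReal} (hφ : Measurable φ) (hφtop : ∫⁻ s, φ s < ⊤)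
    (hG : AEMeasurable G) (hGtop : ∫⁻ τ, G τ < ⊤) :
    ∀ᵐ t : ℝ, ∫⁻ τ, φ (ψ t - ψ τ) * G τ < ⊤ := by
  have hψmeas : Measurable ψ :=
    (continuous_iff_continuousAt.2 fun t => (hderiv t).continuousAt).measurable
  have hmeas : AEMeasurable (Function.uncurry fun t τ : ℝ =>
      ENNReal.ofReal |ψ' t| * (φ (ψ t - ψ τ) * G τ)) (volume.prod volume) := by
    refine AEMeasurable.mul (Measurable.aemeasurable ?_)
      (AEMeasurable.mul (Measurable.aemeasurable ?_) hG.comp_snd)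
    · exact (continuous_abs.measurable.comp (hψ'meas.comp measurable_fst)).ennreal_ofReal
    · exact hφ.comp ((hψmeas.comp measurable_fst).sub (hψmeas.comp measurable_snd))
  have hfin : ∫⁻ t, ∫⁻ τ, ENNReal.ofReal |ψ' t| * (φ (ψ t - ψ τ) * G τ) < ⊤ := by
    rw [lintegral_lintegral_swap hmeas]
    calc ∫⁻ τ, ∫⁻ t, ENNReal.ofReal |ψ' t| * (φ (ψ t - ψ τ) * G τ)
        ≤ ∫⁻ τ, (∫⁻ s, φ s) * G τ := by
          refine lintegral_mono fun τ => ?_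
          simp only [← mul_assoc]
          rw [lintegral_mul_const _ (by fun_prop)]
          refine mul_le_mul_left ?_ _
          exact lintegral_deriv_mul_comp_sub_le hψ hderiv φ (ψ τ)
      _ = (∫⁻ s, φ s) * ∫⁻ τ, G τ := lintegral_const_mul' _ _ hφtop.ne
      _ < ⊤ := ENNReal.mul_lt_top hφtop hGtop
  filter_upwards [ae_lt_top' hmeas.lintegral_prod_right' hfin.ne] with t ht
  simp only [Function.uncurry_apply_pair] at ht
  rw [lintegral_const_mul' _ _ ENNReal.ofReal_ne_top] at ht
  refine ENNReal.lt_top_of_mul_ne_top_right ht.ne ?_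
  simpa using hψ'ne t

/-- For `α ≤ 1` the kernel is at most its truncation plus one. -/
theorem ofReal_rpow_le_truncatedKernel_add_one {α s : ℝ} (hα : α ≤ 1) (hs : 0 < s) :
    ENNReal.ofReal (s ^ (α - 1)) ≤ truncatedKernel α s + 1 := by
  by_cases h : s < 1
  · simp [truncatedKernel, hs, h]
  · refine le_add_left ?_
    rw [ENNReal.ofReal_le_one]
    exact Real.rpow_le_one_of_one_le_of_nonpos (not_lt.1 h) (by linarith)

theorem stmt_1
    (ψ ψ' ω : ℝ → ℝ)
    (hψmono : StrictMono ψ)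
    (hψderiv : ∀ t, HasDerivAt ψ (ψ' t) t)
    (hψ'cont : Continuous ψ')
    (hψ'pos : ∀ t, 0 < ψ' t)
    (hψtop : Tendsto ψ atTop atTop)
    (hψbot : Tendsto ψ atBot atBot)
    (hωmeas : Measurable ω)
    (hωpos : ∀ t, 0 < ω t)
    (hωloc : ∀ K : Set ℝ, IsCompact K → ∃ C > 0, ∀ t ∈ K, ω t ≤ C ∧ C⁻¹ ≤ ω t)
    (α : ℝ) (hα : 0 < α) (hα1 : α < 1)
    (u : ℝ → ℂ)
    (hu : Integrable (fun t : ℝ => ((ω t * ψ' t : ℝ) : ℂ) * u t)) :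
    ∀ᵐ t : ℝ,
      IntegrableOn (fun τ : ℝ => (ψ t - ψ τ) ^ (α - 1) * (‖u τ‖ * (ω τ * ψ' τ))) (Set.Iio t) := by
  have hψmeas : Measurable ψ := hψmono.monotone.measurable
  have hg : Integrable fun τ => ‖u τ‖ * (ω τ * ψ' τ) := by
    refine hu.norm.congr (.of_forall fun τ => ?_)
    simp only [norm_mul, Complex.norm_real]
    rw [Real.norm_of_nonneg (hωpos τ).le, Real.norm_of_nonneg (hψ'pos τ).le, mul_comm]
  have hG := hg.aestronglyMeasurable.enorm
  filter_upwards [ae_lintegral_comp_sub_mul_lt_top hψmono.injective hψderiv hψ'cont.measurable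
    (fun t => (hψ'pos t).ne') (measurable_truncatedKernel α) (lintegral_truncatedKernel_lt_top hα)
    hG hg.2] with t ht
  refine ⟨?_, ?_⟩
  · refine AEStronglyMeasurable.mul ?_ hg.aestronglyMeasurable.restrict
    exact Measurable.aestronglyMeasurable (by fun_prop)
  · calc ∫⁻ τ in Iio t, ‖(ψ t - ψ τ) ^ (α - 1) * (‖u τ‖ * (ω τ * ψ' τ))‖ₑ
        ≤ ∫⁻ τ in Iio t, (truncatedKernel α (ψ t - ψ τ) * ‖‖u τ‖ * (ω τ * ψ' τ)‖ₑ
            + ‖‖u τ‖ * (ω τ * ψ' τ)‖ₑ) := by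
          refine setLIntegral_mono' measurableSet_Iio fun τ hτ => ?_
          have hpos : 0 < ψ t - ψ τ := sub_pos.2 (hψmono hτ)
          rw [enorm_mul, Real.enorm_of_nonneg (Real.rpow_nonneg hpos.le _)]
          refine (mul_le_mul_left (ofReal_rpow_le_truncatedKernel_add_one hα1.le hpos) _).trans_eq ?_
          rw [add_mul, one_mul]
      _ ≤ ∫⁻ τ, (truncatedKernel α (ψ t - ψ τ) * ‖‖u τ‖ * (ω τ * ψ' τ)‖ₑ
            + ‖‖u τ‖ * (ω τ * ψ' τ)‖ₑ) := setLIntegral_le_lintegral _ _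
      _ = (∫⁻ τ, truncatedKernel α (ψ t - ψ τ) * ‖‖u τ‖ * (ω τ * ψ' τ)‖ₑ)
            + ∫⁻ τ, ‖‖u τ‖ * (ω τ * ψ' τ)‖ₑ := lintegral_add_right' _ hG
      _ < ⊤ := ENNReal.add_lt_top.2 ⟨ht, hg.2⟩
end
end

section
/- Let 0 < α < 1 and let u : ℝ → ℂ be such that the function v(y) := ω(ψ⁻¹(y)) u(ψ⁻¹(y)) belongs to the classical Schwartz space 𝓢(ℝ). Then for every t ∈ ℝ the weighted Weyl derivative admits the Marchaud hypersingular representation: (1/(ω(t) ψ'(t))) · d/dt [ ∫_{-∞}^t ((ψ(t) − ψ(τ))^{−α} / Γ(1−α)) ω(τ) u(τ) ψ'(τ) dτ ] = (c_α / ω(t)) ∫_{-∞}^t (ω(t)u(t) − ω(τ)u(τ)) (ψ(t) − ψ(τ))^{−1−α} ψ'(τ) dτ, where c_α := α/Γ(1−α) and both the differentiated integral and the hypersingular integral converge. -/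
open MeasureTheory Set Filter

noncomputable section

/-- The weighted Riemann–Liouville-type integral of order `1 - α` (the inner integral of the
weighted Weyl derivative). -/
def wRL (α : ℝ) (ψ ψ' ω : ℝ → ℝ) (u : ℝ → ℂ) (s : ℝ) : ℂ :=
  ∫ τ in Set.Iio s, (((ψ s - ψ τ) ^ (-α) / Real.Gamma (1 - α) * (ω τ * ψ' τ) : ℝ) : ℂ) * u τ

/-- The integrable majorant `r ^ (-α) / (1 + r) ^ 2` on the positive half-line. -/
theorem integrableOn_rpow_neg_mul_inv_one_add_sq {α : ℝ} (hα : 0 < α) (hα1 : α < 1) :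
    IntegrableOn (fun r : ℝ => r ^ (-α) * ((1 + r) ^ 2)⁻¹) (Ioi 0) := by
  rw [← Ioc_union_Ioi_eq_Ioi zero_le_one]
  have hm : Measurable (fun r : ℝ => r ^ (-α) * ((1 + r) ^ 2)⁻¹) := by fun_prop
  refine IntegrableOn.union ?_ ?_
  · have h : IntegrableOn (fun r : ℝ => r ^ (-α)) (Ioc 0 1) :=
      (intervalIntegral.intervalIntegrable_rpow' (by linarith)).1
    refine h.mono' hm.aestronglyMeasurable ((ae_restrict_mem measurableSet_Ioc).mono ?_)
    intro r hr
    have hr0 : 0 < r := hr.1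
    rw [Real.norm_of_nonneg (by positivity)]
    exact mul_le_of_le_one_right (by positivity) (inv_le_one_of_one_le₀ (by nlinarith))
  · have h : IntegrableOn (fun r : ℝ => r ^ (-2 : ℝ)) (Ioi 1) :=
      integrableOn_Ioi_rpow_of_lt (by norm_num) one_pos
    refine h.mono' hm.aestronglyMeasurable ((ae_restrict_mem measurableSet_Ioi).mono ?_)
    intro r hr
    have hr1 : 1 < r := hr
    have hr0 : 0 < r := by linarith
    rw [Real.norm_of_nonneg (by positivity), Real.rpow_neg hr0.le, Real.rpow_neg hr0.le,
      Real.rpow_two]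
    calc (r ^ α)⁻¹ * ((1 + r) ^ 2)⁻¹ ≤ 1 * ((1 + r) ^ 2)⁻¹ := by
          gcongr
          exact inv_le_one_of_one_le₀ (Real.one_le_rpow hr1.le hα.le)
      _ ≤ (r ^ 2)⁻¹ := by
          rw [one_mul]
          gcongr
          linarith

namespace SchwartzMap

theorem exists_norm_sub_le (f : SchwartzMap ℝ ℂ) (x : ℝ) :
    ∃ C, ∀ r > 0, ∀ y ∈ Metric.ball x 1, ‖f (y - r)‖ ≤ C * ((1 + r) ^ 2)⁻¹ := by
  obtain ⟨C, hC⟩ : ∃ C, ∀ z : ℝ, (1 + |z|) ^ 2 * ‖f z‖ ≤ C :=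
    ⟨_, fun z => by
      simpa using one_add_le_sup_seminorm_apply (𝕜 := ℝ) (m := (2, 0)) le_rfl le_rfl f z⟩
  refine ⟨(2 + |x|) ^ 2 * C, fun r hr y hy => ?_⟩
  rw [Metric.mem_ball, Real.dist_eq] at hy
  have hy' : |y| ≤ 1 + |x| := by
    have := abs_add_le (y - x) x
    rw [sub_add_cancel] at this
    linarith
  have hr' : r ≤ |y - r| + |y| := by
    have := abs_sub_abs_le_abs_sub r y
    rw [abs_of_pos hr, abs_sub_comm] at this
    linarith
  have key : 1 + r ≤ (2 + |x|) * (1 + |y - r|) := by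
    nlinarith [abs_nonneg x, abs_nonneg (y - r)]
  rw [← div_eq_mul_inv, le_div_iff₀ (by positivity)]
  calc ‖f (y - r)‖ * (1 + r) ^ 2 ≤ ‖f (y - r)‖ * ((2 + |x|) * (1 + |y - r|)) ^ 2 := by gcongr
    _ = (2 + |x|) ^ 2 * ((1 + |y - r|) ^ 2 * ‖f (y - r)‖) := by ring
    _ ≤ (2 + |x|) ^ 2 * C := by gcongr; exact hC _

variable {α : ℝ}

theorem integrableOn_rpow_neg_mul (hα : 0 < α) (hα1 : α < 1) (f : SchwartzMap ℝ ℂ) (x : ℝ) :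
    IntegrableOn (fun r : ℝ => ((r ^ (-α) : ℝ) : ℂ) * f (x - r)) (Ioi 0) := by
  obtain ⟨C, hC⟩ := f.exists_norm_sub_le x
  have hm : Measurable (fun r : ℝ => ((r ^ (-α) : ℝ) : ℂ) * f (x - r)) := by
    have := f.continuous.measurable
    fun_prop
  refine ((integrableOn_rpow_neg_mul_inv_one_add_sq hα hα1).const_mul C).mono'
    hm.aestronglyMeasurable ((ae_restrict_mem measurableSet_Ioi).mono fun r hr => ?_)
  have hr0 : 0 < r := hr
  rw [norm_mul, Complex.norm_real, Real.norm_of_nonneg (by positivity), mul_left_comm]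
  gcongr
  exact hC r hr0 x (Metric.mem_ball_self one_pos)

/-- The Riemann–Liouville convolution of a Schwartz function may be differentiated under the
integral sign. -/
theorem hasDerivAt_integral_rpow_neg_mul (hα : 0 < α) (hα1 : α < 1) (f : SchwartzMap ℝ ℂ)
    (x : ℝ) :
    HasDerivAt (fun y : ℝ => ∫ r in Ioi (0 : ℝ), ((r ^ (-α) : ℝ) : ℂ) * f (y - r))
      (∫ r in Ioi (0 : ℝ), ((r ^ (-α) : ℝ) : ℂ) * derivCLM ℝ ℂ f (x - r)) x := by
  obtain ⟨C, hC⟩ := (derivCLM ℝ ℂ f).exists_norm_sub_le x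
  refine (hasDerivAt_integral_of_dominated_loc_of_deriv_le
    (F := fun y r : ℝ => ((r ^ (-α) : ℝ) : ℂ) * f (y - r))
    (F' := fun y r : ℝ => ((r ^ (-α) : ℝ) : ℂ) * derivCLM ℝ ℂ f (y - r))
    (bound := fun r => C * (r ^ (-α) * ((1 + r) ^ 2)⁻¹))
    (Metric.ball_mem_nhds x one_pos)
    (Eventually.of_forall fun y => (f.integrableOn_rpow_neg_mul hα hα1 y).aestronglyMeasurable)
    (f.integrableOn_rpow_neg_mul hα hα1 x)
    ((derivCLM ℝ ℂ f).integrableOn_rpow_neg_mul hα hα1 x).aestronglyMeasurable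
    ((ae_restrict_mem measurableSet_Ioi).mono fun r hr y hy => ?_)
    ((integrableOn_rpow_neg_mul_inv_one_add_sq hα hα1).const_mul C)
    (Eventually.of_forall fun r y _ => ?_)).2
  · have hr0 : 0 < r := hr
    rw [norm_mul, Complex.norm_real, Real.norm_of_nonneg (by positivity), mul_left_comm]
    gcongr
    exact hC r hr0 y hy
  · exact ((f.hasDerivAt (y - r)).comp_sub_const y r).const_mul _

theorem exists_norm_le (f : SchwartzMap ℝ ℂ) : ∃ C, ∀ z, ‖f z‖ ≤ C := by
  obtain ⟨C, -, hC⟩ := f.decay 0 0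
  exact ⟨C, fun z => by simpa using hC z⟩

theorem exists_norm_sub_sub_le (f : SchwartzMap ℝ ℂ) :
    ∃ C, ∀ x, ∀ r > 0, ‖f x - f (x - r)‖ ≤ C * r := by
  obtain ⟨C, hC⟩ := (derivCLM ℝ ℂ f).exists_norm_le
  refine ⟨C, fun x r hr => ?_⟩
  have := Convex.norm_image_sub_le_of_norm_deriv_le (f := f) (s := univ) (C := C)
    (fun z _ => f.differentiableAt) (fun z _ => hC z) convex_univ (mem_univ (x - r)) (mem_univ x)
  simpa [abs_of_pos hr] using this

theorem integrableOn_marchaud (hα : 0 < α) (hα1 : α < 1) (f : SchwartzMap ℝ ℂ) (x : ℝ) :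
    IntegrableOn (fun r : ℝ => ((r ^ (-(1 + α)) : ℝ) : ℂ) * (f x - f (x - r))) (Ioi 0) := by
  obtain ⟨B, hB⟩ := f.exists_norm_le
  obtain ⟨L, hL⟩ := f.exists_norm_sub_sub_le
  have hm : Measurable (fun r : ℝ => ((r ^ (-(1 + α)) : ℝ) : ℂ) * (f x - f (x - r))) := by
    have := f.continuous.measurable
    fun_prop
  rw [← Ioc_union_Ioi_eq_Ioi zero_le_one]
  refine IntegrableOn.union ?_ ?_
  · have h : IntegrableOn (fun r : ℝ => r ^ (-α)) (Ioc 0 1) :=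
      (intervalIntegral.intervalIntegrable_rpow' (by linarith)).1
    refine (h.const_mul L).mono' hm.aestronglyMeasurable
      ((ae_restrict_mem measurableSet_Ioc).mono fun r hr => ?_)
    have hr0 : 0 < r := hr.1
    rw [norm_mul, Complex.norm_real, Real.norm_of_nonneg (by positivity)]
    calc r ^ (-(1 + α)) * ‖f x - f (x - r)‖ ≤ r ^ (-(1 + α)) * (L * r) := by
          gcongr
          exact hL x r hr0
      _ = L * (r ^ (-(1 + α)) * r ^ (1 : ℝ)) := by rw [Real.rpow_one]; ring
      _ = L * r ^ (-α) := by rw [← Real.rpow_add hr0]; ring_nf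
  · have h : IntegrableOn (fun r : ℝ => r ^ (-(1 + α))) (Ioi 1) :=
      integrableOn_Ioi_rpow_of_lt (by linarith) one_pos
    refine (h.const_mul (B + B)).mono' hm.aestronglyMeasurable
      ((ae_restrict_mem measurableSet_Ioi).mono fun r hr => ?_)
    have hr0 : 0 < r := one_pos.trans hr
    rw [norm_mul, Complex.norm_real, Real.norm_of_nonneg (by positivity), mul_comm]
    gcongr
    exact (norm_sub_le _ _).trans (add_le_add (hB _) (hB _))

/-- Integration by parts turns the convolution with the derivative into the Marchaud integral. -/
theorem integral_rpow_neg_mul_deriv (hα : 0 < α) (hα1 : α < 1) (f : SchwartzMap ℝ ℂ) (x : ℝ) :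
    ∫ r in Ioi (0 : ℝ), ((r ^ (-α) : ℝ) : ℂ) * derivCLM ℝ ℂ f (x - r) =
      α * ∫ r in Ioi (0 : ℝ), ((r ^ (-(1 + α)) : ℝ) : ℂ) * (f x - f (x - r)) := by
  obtain ⟨B, hB⟩ := f.exists_norm_le
  obtain ⟨L, hL⟩ := f.exists_norm_sub_sub_le
  have hexp : -α - 1 = -(1 + α) := by ring
  have hu : ∀ r ∈ Ioi (0 : ℝ), HasDerivAt (fun r : ℝ => ((r ^ (-α) : ℝ) : ℂ))
      (-α * ((r ^ (-(1 + α)) : ℝ) : ℂ)) r := fun r hr => by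
    have := (Real.hasDerivAt_rpow_const (p := -α) (Or.inl (ne_of_gt hr))).ofReal_comp
    rw [hexp] at this
    simpa using this
  have hv : ∀ r ∈ Ioi (0 : ℝ), HasDerivAt (fun r : ℝ => f x - f (x - r))
      (derivCLM ℝ ℂ f (x - r)) r := fun r _ => by
    simpa using ((f.hasDerivAt (x - r)).comp_const_sub x r).const_sub (f x)
  have h0 : Tendsto ((fun r : ℝ => ((r ^ (-α) : ℝ) : ℂ)) * fun r : ℝ => f x - f (x - r))
      (nhdsWithin 0 (Ioi 0)) (nhds 0) := by
    have hlim : Tendsto (fun r : ℝ => L * r ^ (1 - α)) (nhdsWithin 0 (Ioi 0)) (nhds 0) := by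
      have hc : ContinuousAt (fun r : ℝ => L * r ^ (1 - α)) 0 :=
        (Real.continuousAt_rpow_const 0 (1 - α) (Or.inr (by linarith))).const_mul L
      have := hc.tendsto
      rw [Real.zero_rpow (by linarith), mul_zero] at this
      exact this.mono_left nhdsWithin_le_nhds
    refine squeeze_zero_norm' (eventually_mem_nhdsWithin.mono fun r hr => ?_) hlim
    have hr0 : 0 < r := hr
    rw [Pi.mul_apply, norm_mul, Complex.norm_real, Real.norm_of_nonneg (by positivity)]
    calc r ^ (-α) * ‖f x - f (x - r)‖ ≤ r ^ (-α) * (L * r) := by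
          gcongr
          exact hL x r hr0
      _ = L * (r ^ (-α) * r ^ (1 : ℝ)) := by rw [Real.rpow_one]; ring
      _ = L * r ^ (1 - α) := by rw [← Real.rpow_add hr0]; ring_nf
  have htop : Tendsto ((fun r : ℝ => ((r ^ (-α) : ℝ) : ℂ)) * fun r : ℝ => f x - f (x - r))
      atTop (nhds 0) := by
    have hlim : Tendsto (fun r : ℝ => r ^ (-α) * (B + B)) atTop (nhds 0) := by
      simpa using (tendsto_rpow_neg_atTop hα).mul_const (B + B)
    refine squeeze_zero_norm' ((eventually_gt_atTop 0).mono fun r hr => ?_) hlim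
    rw [Pi.mul_apply, norm_mul, Complex.norm_real, Real.norm_of_nonneg (by positivity)]
    gcongr
    exact (norm_sub_le _ _).trans (add_le_add (hB _) (hB _))
  have hint := (f.integrableOn_marchaud hα hα1 x).const_mul (-α : ℂ)
  simp only [← mul_assoc] at hint
  rw [integral_Ioi_mul_deriv_eq_deriv_mul hu hv
    ((derivCLM ℝ ℂ f).integrableOn_rpow_neg_mul hα hα1 x) hint h0 htop]
  simp only [mul_assoc, integral_const_mul]
  ring

end SchwartzMap

section Substitution

variable {ψ ψ' : ℝ → ℝ}

theorem image_sub_Iio_eq_Ioi (hmono : StrictMono ψ) (hsurj : Function.Surjective ψ) (t : ℝ) :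
    (fun τ => ψ t - ψ τ) '' Iio t = Ioi 0 := by
  ext r
  constructor
  · rintro ⟨τ, hτ, rfl⟩
    exact sub_pos.2 (hmono hτ)
  · intro hr
    obtain ⟨τ, hτ⟩ := hsurj (ψ t - r)
    have hr0 : 0 < r := hr
    exact ⟨τ, hmono.lt_iff_lt.1 (by linarith), by simp [hτ]⟩

theorem integrableOn_Iio_comp_sub_iff (hmono : StrictMono ψ) (hsurj : Function.Surjective ψ)
    (hderiv : ∀ t, HasDerivAt ψ (ψ' t) t) (hpos : ∀ t, 0 < ψ' t) (g : ℝ → ℂ) (t : ℝ) :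
    IntegrableOn (fun τ => (ψ' τ : ℂ) * g (ψ t - ψ τ)) (Iio t) ↔ IntegrableOn g (Ioi 0) := by
  rw [← image_sub_Iio_eq_Ioi hmono hsurj t, integrableOn_image_iff_integrableOn_abs_deriv_smul
    measurableSet_Iio (fun τ _ => ((hderiv τ).const_sub (ψ t)).hasDerivWithinAt)
    (fun a _ b _ h => hmono.injective (by simpa using h))]
  simp [abs_of_pos (hpos _)]

theorem integral_Iio_comp_sub (hmono : StrictMono ψ) (hsurj : Function.Surjective ψ)
    (hderiv : ∀ t, HasDerivAt ψ (ψ' t) t) (hpos : ∀ t, 0 < ψ' t) (g : ℝ → ℂ) (t : ℝ) :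
    ∫ τ in Iio t, (ψ' τ : ℂ) * g (ψ t - ψ τ) = ∫ r in Ioi 0, g r := by
  rw [← image_sub_Iio_eq_Ioi hmono hsurj t, integral_image_eq_integral_abs_deriv_smul
    measurableSet_Iio (fun τ _ => ((hderiv τ).const_sub (ψ t)).hasDerivWithinAt)
    (fun a _ b _ h => hmono.injective (by simpa using h))]
  simp [abs_of_pos (hpos _)]

end Substitution

theorem stmt_2
    (ψ ψ' ω : ℝ → ℝ)
    (hψmono : StrictMono ψ)
    (hψderiv : ∀ t, HasDerivAt ψ (ψ' t) t)
    (hψ'cont : Continuous ψ')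
    (hψ'pos : ∀ t, 0 < ψ' t)
    (hψtop : Tendsto ψ atTop atTop)
    (hψbot : Tendsto ψ atBot atBot)
    (hωmeas : Measurable ω)
    (hωpos : ∀ t, 0 < ω t)
    (hωloc : ∀ K : Set ℝ, IsCompact K → ∃ C > 0, ∀ t ∈ K, ω t ≤ C ∧ C⁻¹ ≤ ω t)
    (α : ℝ) (hα : 0 < α) (hα1 : α < 1)
    (u : ℝ → ℂ)
    (V : SchwartzMap ℝ ℂ)
    (hV : ∀ y : ℝ, V y = (ω (Function.invFun ψ y) : ℂ) * u (Function.invFun ψ y)) :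
    ∀ t : ℝ,
      -- the Riemann–Liouville integrand converges absolutely
      IntegrableOn
        (fun τ : ℝ => (((ψ t - ψ τ) ^ (-α) / Real.Gamma (1 - α) * (ω τ * ψ' τ) : ℝ) : ℂ) * u τ)
        (Set.Iio t) ∧
      -- the hypersingular (Marchaud) integral converges absolutely
      IntegrableOn
        (fun τ : ℝ => (((ω t : ℝ) : ℂ) * u t - ((ω τ : ℝ) : ℂ) * u τ) *
          (((ψ t - ψ τ) ^ (-(1 + α)) * ψ' τ : ℝ) : ℂ)) (Set.Iio t) ∧
      -- (1/(ω ψ')) d/dt [RL integral] = Marchaud form; equivalently the derivative of the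
      -- RL integral equals ω(t)ψ'(t) times the Marchaud expression
      HasDerivAt (wRL α ψ ψ' ω u)
        (((ω t * ψ' t : ℝ) : ℂ) *
          (((α / Real.Gamma (1 - α) / ω t : ℝ) : ℂ) *
            ∫ τ in Set.Iio t, (((ω t : ℝ) : ℂ) * u t - ((ω τ : ℝ) : ℂ) * u τ) *
              (((ψ t - ψ τ) ^ (-(1 + α)) * ψ' τ : ℝ) : ℂ))) t := by
  have hψcont : Continuous ψ :=
    continuous_iff_continuousAt.2 fun t => (hψderiv t).continuousAt
  have hsurj : Function.Surjective ψ := hψcont.surjective hψtop hψbot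
  have hV' : ∀ τ, (ω τ : ℂ) * u τ = V (ψ τ) := fun τ => by
    rw [hV, Function.leftInverse_invFun hψmono.injective τ]
  obtain ⟨G, hG⟩ : ∃ G : ℝ → ℝ → ℂ, G = fun s r =>
    ((Real.Gamma (1 - α) : ℝ) : ℂ)⁻¹ * (((r ^ (-α) : ℝ) : ℂ) * V (ψ s - r)) := ⟨_, rfl⟩
  obtain ⟨M, hM⟩ : ∃ M : ℝ → ℝ → ℂ, M = fun s r =>
    ((r ^ (-(1 + α)) : ℝ) : ℂ) * (V (ψ s) - V (ψ s - r)) := ⟨_, rfl⟩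
  have hRL : ∀ s, (fun τ : ℝ =>
      (((ψ s - ψ τ) ^ (-α) / Real.Gamma (1 - α) * (ω τ * ψ' τ) : ℝ) : ℂ) * u τ) =
      fun τ => (ψ' τ : ℂ) * G s (ψ s - ψ τ) := fun s => by
    funext τ
    simp only [hG, sub_sub_cancel, ← hV']
    push_cast
    ring
  have hMarchaud : ∀ s, (fun τ : ℝ => ((ω s : ℂ) * u s - (ω τ : ℂ) * u τ) *
      (((ψ s - ψ τ) ^ (-(1 + α)) * ψ' τ : ℝ) : ℂ)) =
      fun τ => (ψ' τ : ℂ) * M s (ψ s - ψ τ) := fun s => by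
    funext τ
    simp only [hM, sub_sub_cancel, ← hV']
    push_cast
    ring
  have hw : wRL α ψ ψ' ω u = fun s => ((Real.Gamma (1 - α) : ℝ) : ℂ)⁻¹ *
      ∫ r in Ioi (0 : ℝ), ((r ^ (-α) : ℝ) : ℂ) * V (ψ s - r) := by
    funext s
    rw [wRL, hRL, integral_Iio_comp_sub hψmono hsurj hψderiv hψ'pos, hG, integral_const_mul]
  intro t
  refine ⟨?_, ?_, ?_⟩
  · rw [hRL, integrableOn_Iio_comp_sub_iff hψmono hsurj hψderiv hψ'pos, hG]
    exact (V.integrableOn_rpow_neg_mul hα hα1 (ψ t)).const_mul _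
  · rw [hMarchaud, integrableOn_Iio_comp_sub_iff hψmono hsurj hψderiv hψ'pos, hM]
    exact V.integrableOn_marchaud hα hα1 (ψ t)
  · rw [hMarchaud, integral_Iio_comp_sub hψmono hsurj hψderiv hψ'pos, hM, hw]
    have h := ((V.hasDerivAt_integral_rpow_neg_mul hα hα1 (ψ t)).scomp t (hψderiv t)).const_mul
      (((Real.Gamma (1 - α) : ℝ) : ℂ)⁻¹)
    rw [V.integral_rpow_neg_mul_deriv hα hα1] at h
    refine h.congr_deriv ?_
    have hω : (ω t : ℂ) ≠ 0 := Complex.ofReal_ne_zero.2 (hωpos t).ne'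
    rw [Complex.real_smul]
    push_cast
    field_simp
end
end

section
/- Let 0 < α < 1, λ > 0, and let f : ℝ → ℂ be such that the function y ↦ ω(ψ⁻¹(y)) f(ψ⁻¹(y)) belongs to the Schwartz space 𝓢(ℝ). Define σ(t) := (1/ω(t)) ∫_{-∞}^t (ψ(t) − ψ(τ))^{α−1} E_{α,α}(−λ (ψ(t) − ψ(τ))^α) f(τ) ω(τ) ψ'(τ) dτ. Then for almost every t ∈ ℝ, σ satisfies the aging Kelvin–Voigt equation 𝔇^α_{ψ,ω}σ(t) + λ σ(t) = f(t), where 𝔇^α_{ψ,ω}σ(t) := (c_α/ω(t)) ∫_{-∞}^t (ω(t)σ(t) − ω(τ)σ(τ)) (ψ(t) − ψ(τ))^{−1−α} ψ'(τ) dτ with c_α = α/Γ(1−α). -/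
open MeasureTheory Set Filter

noncomputable section

/-- The two-parameter Mittag-Leffler function (real argument). -/
def mlE (α β x : ℝ) : ℝ := ∑' k : ℕ, x ^ k / Real.Gamma (α * k + β)

/-- The weighted Weyl–Marchaud fractional derivative. -/
def wD (α : ℝ) (ψ ψ' ω : ℝ → ℝ) (u : ℝ → ℂ) (t : ℝ) : ℂ :=
  ((α / Real.Gamma (1 - α) / ω t : ℝ) : ℂ) *
    ∫ τ in Set.Iio t,
      (((ω t : ℝ) : ℂ) * u t - ((ω τ : ℝ) : ℂ) * u τ) *
        (((ψ t - ψ τ) ^ (-(1 + α)) * ψ' τ : ℝ) : ℂ)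

/-- The stress response: weighted convolution of the aging Green's function with `f`. -/
def sigmaSol (α lam : ℝ) (ψ ψ' ω : ℝ → ℝ) (f : ℝ → ℂ) (t : ℝ) : ℂ :=
  ((ω t : ℝ) : ℂ)⁻¹ *
    ∫ τ in Set.Iio t,
      (((ψ t - ψ τ) ^ (α - 1) * mlE α α (-(lam * (ψ t - ψ τ) ^ α)) * (ω τ * ψ' τ) : ℝ) : ℂ) * f τ


/-- The Euler beta integral over `(0, w)`. -/
lemma integral_Ioo_beta {a b w : ℝ} (ha : 0 < a) (hb : 0 < b) (hw : 0 < w) :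
    ∫ r in Ioo 0 w, (w - r) ^ (b - 1) * r ^ (a - 1) =
      w ^ (a + b - 1) * (Real.Gamma a * Real.Gamma b / Real.Gamma (a + b)) := by
  have h := Complex.betaIntegral_scaled (a : ℂ) (b : ℂ) hw
  have hB : Complex.betaIntegral a b =
      ((Real.Gamma a * Real.Gamma b / Real.Gamma (a + b) : ℝ) : ℂ) := by
    have h2 := Complex.Gamma_mul_Gamma_eq_betaIntegral (s := (a : ℂ)) (t := (b : ℂ))
      (by simpa using ha) (by simpa using hb)
    rw [← Complex.ofReal_add, Complex.Gamma_ofReal, Complex.Gamma_ofReal,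
      Complex.Gamma_ofReal] at h2
    have h3 : (Real.Gamma (a + b) : ℂ) ≠ 0 := by
      exact_mod_cast (Real.Gamma_pos_of_pos (add_pos ha hb)).ne'
    push_cast
    rw [h2]
    field_simp
  rw [hB, intervalIntegral.integral_of_le hw.le, integral_Ioc_eq_integral_Ioo] at h
  have h4 : ((w : ℂ) ^ ((a : ℂ) + b - 1)) = ((w ^ (a + b - 1) : ℝ) : ℂ) := by
    rw [Complex.ofReal_cpow hw.le]
    push_cast
    rfl
  rw [h4, ← Complex.ofReal_mul] at h
  have h5 : ∫ x in Ioo 0 w, (x : ℂ) ^ ((a : ℂ) - 1) * ((w : ℂ) - x) ^ ((b : ℂ) - 1) =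
      ((∫ r in Ioo 0 w, (w - r) ^ (b - 1) * r ^ (a - 1) : ℝ) : ℂ) := by
    rw [← integral_complex_ofReal]
    refine setIntegral_congr_fun measurableSet_Ioo fun x hx => ?_
    rw [Complex.ofReal_mul, Complex.ofReal_cpow hx.1.le, Complex.ofReal_cpow (sub_nonneg.2 hx.2.le)]
    push_cast
    ring
  rw [h5] at h
  exact_mod_cast h

lemma integrableOn_Ioo_beta {a b w : ℝ} (ha : 0 < a) (hb : 0 < b) (hw : 0 < w) :
    IntegrableOn (fun r => (w - r) ^ (b - 1) * r ^ (a - 1)) (Ioo 0 w) := by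
  by_contra h
  have h1 := integral_Ioo_beta ha hb hw
  rw [integral_undef h] at h1
  have := Real.Gamma_pos_of_pos ha
  have := Real.Gamma_pos_of_pos hb
  have := Real.Gamma_pos_of_pos (add_pos ha hb)
  have : 0 < w ^ (a + b - 1) * (Real.Gamma a * Real.Gamma b / Real.Gamma (a + b)) := by positivity
  linarith

lemma rpow_mul_exp_le_Gamma {M s : ℝ} (hM : 0 < M) (hs : 1 ≤ s) :
    M ^ (s - 1) * Real.exp (-M) ≤ Real.Gamma s := by
  have hs0 : 0 < s := by linarith
  rw [Real.Gamma_eq_integral hs0]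
  have hint := Real.GammaIntegral_convergent hs0
  have hle : ∫ x in Ioi M, M ^ (s - 1) * Real.exp (-x) ≤
      ∫ x in Ioi M, Real.exp (-x) * x ^ (s - 1) := by
    refine setIntegral_mono_on ((integrableOn_exp_neg_Ioi M).const_mul _)
      (hint.mono_set (Ioi_subset_Ioi hM.le)) measurableSet_Ioi fun x hx => ?_
    rw [mul_comm]
    have : M ^ (s - 1) ≤ x ^ (s - 1) :=
      Real.rpow_le_rpow hM.le (le_of_lt hx) (by linarith)
    gcongr
  rw [integral_const_mul, integral_exp_neg_Ioi] at hle
  refine hle.trans (setIntegral_mono_set hint ?_ (Ioi_subset_Ioi hM.le).eventuallyLE)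
  filter_upwards [ae_restrict_mem measurableSet_Ioi] with x hx
  have : 0 < x := hx
  positivity

lemma summable_mlE {α β : ℝ} (hα : 0 < α) (hβ : 0 < β) {R : ℝ} (hR : 0 ≤ R) :
    Summable fun k : ℕ => R ^ k / Real.Gamma (α * k + β) := by
  set M : ℝ := (2 * R + 1) ^ (1 / α) with hMdef
  have hM : 0 < M := by positivity
  have hMα : M ^ α = 2 * R + 1 := by
    rw [hMdef, ← Real.rpow_mul (by positivity)]
    field_simp
    simp
  obtain ⟨N, hN⟩ := exists_nat_gt (1 / α)
  have hkα : ∀ k : ℕ, N ≤ k → 1 ≤ α * k + β := fun k hk => by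
    have : (N : ℝ) ≤ k := by exact_mod_cast hk
    have h1 : 1 / α < k := by linarith
    rw [div_lt_iff₀ hα] at h1
    linarith
  refine Summable.of_norm_bounded_eventually_nat
    (g := fun k => (1 / 2 : ℝ) ^ k * (Real.exp M / M ^ (β - 1))) ?_ ?_
  · exact (summable_geometric_of_lt_one (by norm_num) (by norm_num)).mul_right _
  · filter_upwards [eventually_ge_atTop N] with k hk
    have hG := rpow_mul_exp_le_Gamma hM (hkα k hk)
    have hpos : 0 < M ^ (α * k + β - 1) * Real.exp (-M) := by positivity
    have hGp : 0 < Real.Gamma (α * k + β) := hpos.trans_le hG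
    rw [Real.norm_of_nonneg (by positivity)]
    have e1 : M ^ (α * k + β - 1) = (2 * R + 1) ^ k * M ^ (β - 1) := by
      rw [show α * k + β - 1 = α * k + (β - 1) by ring, Real.rpow_add hM, Real.rpow_mul hM.le,
        hMα, Real.rpow_natCast]
    calc R ^ k / Real.Gamma (α * k + β)
        ≤ R ^ k / (M ^ (α * k + β - 1) * Real.exp (-M)) := by gcongr
      _ = (R / (2 * R + 1)) ^ k * (Real.exp M / M ^ (β - 1)) := by
        rw [e1, Real.exp_neg, div_pow]
        field_simp
      _ ≤ _ := by
        have : R / (2 * R + 1) ≤ 1 / 2 := by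
          rw [div_le_div_iff₀ (by positivity) (by norm_num)]
          linarith
        gcongr

lemma summable_mlE' {α β : ℝ} (hα : 0 < α) (hβ : 0 < β) (x : ℝ) :
    Summable fun k : ℕ => x ^ k / Real.Gamma (α * k + β) := by
  refine Summable.of_norm ((summable_mlE hα hβ (abs_nonneg x)).congr fun k => ?_)
  have : 0 < Real.Gamma (α * k + β) := Real.Gamma_pos_of_pos (by positivity)
  rw [norm_div, norm_pow, Real.norm_eq_abs, Real.norm_of_nonneg this.le]

lemma continuous_mlE {α β : ℝ} (hα : 0 < α) (hβ : 0 < β) : Continuous (mlE α β) := by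
  rw [continuous_iff_continuousAt]
  intro x
  have h : ContinuousOn (mlE α β) (Metric.ball 0 (|x| + 1)) := by
    refine continuousOn_tsum (fun k => by fun_prop)
      (summable_mlE hα hβ (R := |x| + 1) (by positivity)) fun k y hy => ?_
    have : 0 < Real.Gamma (α * k + β) := Real.Gamma_pos_of_pos (by positivity)
    rw [norm_div, norm_pow, Real.norm_of_nonneg this.le]
    have hy' : ‖y‖ ≤ |x| + 1 := by simpa using (mem_ball_zero_iff.1 hy).le
    gcongr
  exact h.continuousAt (Metric.isOpen_ball.mem_nhds (by simp))

lemma continuous_mlE_rpow {α : ℝ} (hα : 0 < α) (lam : ℝ) :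
    Continuous fun r : ℝ => mlE α α (-(lam * r ^ α)) :=
  (continuous_mlE hα hα).comp ((continuous_const.mul (Real.continuous_rpow_const hα.le)).neg)

lemma mlE_eq_add {α β : ℝ} (hα : 0 < α) (hβ : 0 < β) (x : ℝ) :
    mlE α β x = 1 / Real.Gamma β + x * mlE α (α + β) x := by
  rw [mlE, (summable_mlE' hα hβ x).tsum_eq_zero_add, mlE, ← tsum_mul_left]
  congr 1
  · simp
  · refine tsum_congr fun k => ?_
    push_cast
    rw [show α * (k + 1) + β = α * k + (α + β) by ring, pow_succ]
    ring

/-- The Green's function `r ^ (α - 1) E_{α,α}(-lam r ^ α)`. -/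
def greenFn (α lam r : ℝ) : ℝ := r ^ (α - 1) * mlE α α (-(lam * r ^ α))

lemma hasSum_greenFn {α : ℝ} (hα : 0 < α) (lam : ℝ) {r : ℝ} (hr : 0 < r) :
    HasSum (fun k : ℕ => (-lam) ^ k / Real.Gamma (α * k + α) * r ^ (α * k + α - 1))
      (greenFn α lam r) := by
  refine ((summable_mlE' hα hα (-(lam * r ^ α))).hasSum.mul_left (r ^ (α - 1))).congr_fun ?_
  intro k
  rw [show α * k + α - 1 = α - 1 + α * k by ring, Real.rpow_add hr, Real.rpow_mul hr.le,
    Real.rpow_natCast, neg_mul_eq_neg_mul, mul_pow]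
  ring

/-- Fractional integral of order `β` of the Green's function. -/
lemma integral_rpow_mul_greenFn {α β w : ℝ} (hα : 0 < α) (hβ : 0 < β) (lam : ℝ) (hw : 0 < w) :
    IntegrableOn (fun r => (w - r) ^ (β - 1) * greenFn α lam r) (Ioo 0 w) ∧
    ∫ r in Ioo 0 w, (w - r) ^ (β - 1) * greenFn α lam r =
      Real.Gamma β * (w ^ (α + β - 1) * mlE α (α + β) (-(lam * w ^ α))) := by
  have hpos : ∀ k : ℕ, 0 < α * k + α := fun k => by positivity
  have hG : ∀ k : ℕ, 0 < Real.Gamma (α * k + α) := fun k => Real.Gamma_pos_of_pos (hpos k)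
  have hval : ∀ (c : ℝ) (k : ℕ), ∫ r in Ioo 0 w, c ^ k / Real.Gamma (α * k + α) *
      ((w - r) ^ (β - 1) * r ^ (α * k + α - 1)) =
      Real.Gamma β * (w ^ (α + β - 1) * ((c * w ^ α) ^ k / Real.Gamma (α * k + (α + β)))) := by
    intro c k
    rw [integral_const_mul, integral_Ioo_beta (hpos k) hβ hw, mul_pow,
      show α * k + α + β - 1 = α + β - 1 + α * k by ring, Real.rpow_add hw, Real.rpow_mul hw.le,
      Real.rpow_natCast, add_assoc (α * (k : ℝ))]
    have := (hG k).ne'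
    field_simp
  have hnorm : ∀ k : ℕ, ∫ r in Ioo 0 w, ‖(-lam) ^ k / Real.Gamma (α * k + α) *
      ((w - r) ^ (β - 1) * r ^ (α * k + α - 1))‖ =
      ∫ r in Ioo 0 w, |lam| ^ k / Real.Gamma (α * k + α) *
        ((w - r) ^ (β - 1) * r ^ (α * k + α - 1)) := by
    refine fun k => setIntegral_congr_fun measurableSet_Ioo fun r hr => ?_
    have h1 : 0 ≤ (w - r) ^ (β - 1) := Real.rpow_nonneg (sub_nonneg.2 hr.2.le) _
    have h2 : 0 ≤ r ^ (α * k + α - 1) := Real.rpow_nonneg hr.1.le _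
    simp only [norm_mul, norm_div, norm_pow, norm_neg, Real.norm_of_nonneg h1,
      Real.norm_of_nonneg h2, Real.norm_of_nonneg (hG k).le, Real.norm_eq_abs]
  constructor
  · have hc := continuous_mlE_rpow hα lam
    obtain ⟨C, hC⟩ := (isCompact_Icc (a := 0) (b := w)).exists_bound_of_continuousOn hc.continuousOn
    have := Integrable.mul_bdd (c := C) (integrableOn_Ioo_beta hα hβ hw)
      (hc.aestronglyMeasurable (μ := volume.restrict (Ioo 0 w)))
      (by
        filter_upwards [ae_restrict_mem measurableSet_Ioo] with r hr
        exact hC r (Ioo_subset_Icc_self hr))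
    refine this.congr (ae_of_all _ fun r => ?_)
    simp only [greenFn]
    ring
  · have hs := hasSum_integral_of_summable_integral_norm (μ := volume.restrict (Ioo 0 w))
      (F := fun (k : ℕ) (r : ℝ) => (-lam) ^ k / Real.Gamma (α * k + α) *
        ((w - r) ^ (β - 1) * r ^ (α * k + α - 1)))
      (fun k => (integrableOn_Ioo_beta (hpos k) hβ hw).const_mul _) (by
        simp_rw [hnorm, hval]
        exact ((summable_mlE' hα (add_pos hα hβ) _).mul_left _).mul_left _)
    simp_rw [hval] at hs
    rw [← neg_mul, mlE, ← tsum_mul_left, ← tsum_mul_left, hs.tsum_eq]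
    refine setIntegral_congr_fun measurableSet_Ioo fun r hr => ?_
    refine (((hasSum_greenFn hα lam hr.1).mul_left ((w - r) ^ (β - 1))).congr_fun fun k => ?_
      ).tsum_eq.symm
    ring

lemma measurable_greenFn {α : ℝ} (hα : 0 < α) (lam : ℝ) : Measurable (greenFn α lam) :=
  (measurable_id.pow_const _).mul (continuous_mlE_rpow hα lam).measurable

lemma continuousOn_greenFn {α : ℝ} (hα : 0 < α) (lam : ℝ) :
    ContinuousOn (greenFn α lam) (Ioi 0) := fun r hr =>
  ((Real.continuousAt_rpow_const r (α - 1) (Or.inl (ne_of_gt hr))).mul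
    (continuous_mlE_rpow hα lam).continuousAt).continuousWithinAt

/-- The Volterra equation satisfied by the Green's function. -/
lemma greenFn_volterra {α w : ℝ} (hα : 0 < α) (lam : ℝ) (hw : 0 < w) :
    lam * ∫ r in Ioo 0 w, (w - r) ^ (α - 1) * greenFn α lam r =
      w ^ (α - 1) - Real.Gamma α * greenFn α lam w := by
  rw [(integral_rpow_mul_greenFn hα hα lam hw).2, greenFn, mlE_eq_add hα hα,
    show α + α - 1 = (α - 1) + α by ring, Real.rpow_add hw]
  have := (Real.Gamma_pos_of_pos hα).ne'
  field_simp
  ring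

lemma integrableOn_Ioo_greenFn {α w : ℝ} (hα : 0 < α) (lam : ℝ) (hw : 0 < w) :
    IntegrableOn (greenFn α lam) (Ioo 0 w) := by
  simpa using (integral_rpow_mul_greenFn hα one_pos lam hw).1

/-- Convolution of the Green's function with the Sonine kernel. -/
lemma integral_sonine_greenFn {α w : ℝ} (hα : 0 < α) (hα1 : α < 1) (lam : ℝ) (hw : 0 < w) :
    ∫ r in Ioo 0 w, (w - r) ^ (-α) * greenFn α lam r =
      Real.Gamma (1 - α) * (1 - lam * ∫ r in Ioo 0 w, greenFn α lam r) := by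
  have h1 := (integral_rpow_mul_greenFn hα (sub_pos.2 hα1) lam hw).2
  have h2 := (integral_rpow_mul_greenFn hα one_pos lam hw).2
  simp only [sub_self, Real.rpow_zero, one_mul, Real.Gamma_one, add_sub_cancel_right] at h2
  rw [show 1 - α - 1 = -α by ring, show α + (1 - α) = 1 by ring, mlE_eq_add hα one_pos] at h1
  rw [h1, h2, sub_self, Real.rpow_zero, Real.Gamma_one]
  ring

lemma greenFn_pos {α lam : ℝ} (hα : 0 < α) (hα1 : α < 1) (hlam : 0 < lam) {r : ℝ} (hr : 0 < r) :
    0 < greenFn α lam r := by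
  set h : ℝ → ℝ := fun r => mlE α α (-(lam * r ^ α)) with hh
  have hcont : Continuous h := continuous_mlE_rpow hα lam
  have hΓ := Real.Gamma_pos_of_pos hα
  have h0 : 0 < h 0 := by
    simp only [hh, Real.zero_rpow hα.ne', mul_zero, neg_zero]
    rw [mlE_eq_add hα hα]
    simpa using hΓ
  suffices H : ∀ x, 0 ≤ x → 0 < h x from mul_pos (Real.rpow_pos_of_pos hr _) (H r hr.le)
  by_contra! hneg
  set Z : Set ℝ := Ici 0 ∩ h ⁻¹' Iic 0 with hZ
  have hZc : IsClosed Z := isClosed_Ici.inter (isClosed_Iic.preimage hcont)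
  have hZne : Z.Nonempty := hneg
  have hZb : BddBelow Z := ⟨0, fun x hx => hx.1⟩
  set T := sInf Z with hT
  obtain ⟨hT0', hTneg⟩ : T ∈ Z := hZc.csInf_mem hZne hZb
  have hT0 : 0 < T := lt_of_le_of_ne hT0' fun he => by
    rw [← he] at hTneg
    exact absurd hTneg (not_le.2 h0)
  have hgpos : ∀ s, 0 < s → s < T → 0 < greenFn α lam s := fun s hs hsT =>
    mul_pos (Real.rpow_pos_of_pos hs _) (not_le.1 fun hle =>
      absurd (csInf_le hZb (show s ∈ Z from ⟨hs.le, hle⟩)) (not_le.2 hsT))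
  have hgT : greenFn α lam T ≤ 0 :=
    mul_nonpos_of_nonneg_of_nonpos (Real.rpow_nonneg hT0' _) hTneg
  obtain ⟨t₀, ht₀, ht₀T, hclose⟩ : ∃ t₀, 0 < t₀ ∧ t₀ < T ∧ ∀ t, t₀ ≤ t → t ≤ T →
      0 < Real.Gamma α * (T / t) ^ (α - 1) - lam * ((T - t) ^ α / α) := by
    have hc : ContinuousAt (fun t => Real.Gamma α * (T / t) ^ (α - 1) -
        lam * ((T - t) ^ α / α)) T := by
      refine ContinuousAt.sub (continuousAt_const.mul ?_) (continuousAt_const.mul ?_)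
      · exact (continuousAt_const.div continuousAt_id hT0.ne').rpow_const
          (Or.inl (div_ne_zero hT0.ne' hT0.ne'))
      · exact ((continuousAt_const.sub continuousAt_id).rpow_const (Or.inr hα.le)).div_const _
    have hev := hc.tendsto.eventually_const_lt (u := 0) (by
      simp only [sub_self, Real.zero_rpow hα.ne', div_self hT0.ne']
      simpa using hΓ)
    obtain ⟨ε, hε, hball⟩ := Metric.eventually_nhds_iff.1 hev
    refine ⟨max (T / 2) (T - ε / 2), lt_max_of_lt_left (by positivity),
      max_lt (by linarith) (by linarith), fun t ht htT => hball ?_⟩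
    have := (le_max_right _ _).trans ht
    rw [Real.dist_eq, abs_lt]
    constructor <;> linarith
  obtain ⟨t, ht, hmax⟩ := (isCompact_Icc (a := t₀) (b := T)).exists_isMaxOn
    (nonempty_Icc.2 ht₀T.le)
    ((continuousOn_greenFn hα lam).mono fun x hx => ht₀.trans_le hx.1)
  have hgt : 0 < greenFn α lam t :=
    (hgpos t₀ ht₀ ht₀T).trans_le (hmax (left_mem_Icc.2 ht₀T.le))
  have htT : t < T := lt_of_le_of_ne ht.2 fun he => by
    rw [he] at hgt
    linarith
  have ht0 : 0 < t := ht₀.trans_le ht.1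
  have hI := (integral_rpow_mul_greenFn hα hα lam hT0).1
  have hIt := (integral_rpow_mul_greenFn hα hα lam ht0).1
  have hsplit : ∫ s in Ioo 0 T, (T - s) ^ (α - 1) * greenFn α lam s =
      (∫ s in Ioo 0 t, (T - s) ^ (α - 1) * greenFn α lam s) +
        ∫ s in Ico t T, (T - s) ^ (α - 1) * greenFn α lam s := by
    rw [← Ioo_union_Ico_eq_Ioo ht0 htT.le]
    refine setIntegral_union ?_ measurableSet_Ico (hI.mono_set (Ioo_subset_Ioo_right htT.le))
      (hI.mono_set fun s hs => ⟨ht0.trans_le hs.1, hs.2⟩)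
    exact Set.disjoint_left.2 fun s hs hs' => absurd hs.2 (not_lt.2 hs'.1)
  have hle1 : ∫ s in Ioo 0 t, (T - s) ^ (α - 1) * greenFn α lam s ≤
      (T / t) ^ (α - 1) * ∫ s in Ioo 0 t, (t - s) ^ (α - 1) * greenFn α lam s := by
    rw [← integral_const_mul]
    refine setIntegral_mono_on (hI.mono_set (Ioo_subset_Ioo_right htT.le)) (hIt.const_mul _)
      measurableSet_Ioo fun s hs => ?_
    rw [← mul_assoc, ← Real.mul_rpow (by positivity) (sub_nonneg.2 hs.2.le)]
    refine mul_le_mul_of_nonneg_right ?_ (hgpos s hs.1 (hs.2.trans htT)).le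
    refine Real.rpow_le_rpow_of_nonpos (mul_pos (by positivity) (sub_pos.2 hs.2)) ?_ (by linarith)
    rw [div_mul_eq_mul_div, div_le_iff₀ ht0]
    nlinarith [hs.1]
  have hker : IntegrableOn (fun s => (T - s) ^ (α - 1)) (Ico t T) ∧
      ∫ s in Ico t T, (T - s) ^ (α - 1) = (T - t) ^ α / α := by
    constructor
    · rw [integrableOn_Ico_iff_integrableOn_Ioo, ← integrableOn_Ioc_iff_integrableOn_Ioo,
        ← intervalIntegrable_iff_integrableOn_Ioc_of_le htT.le]
      have := (intervalIntegral.intervalIntegrable_rpow' (a := T - t) (b := 0)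
        (r := α - 1) (by linarith)).comp_sub_left T
      simpa using this
    · rw [integral_Ico_eq_integral_Ioo, ← integral_Ioc_eq_integral_Ioo,
        ← intervalIntegral.integral_of_le htT.le,
        intervalIntegral.integral_comp_sub_left (fun x => x ^ (α - 1)) T,
        integral_rpow (Or.inl (by linarith))]
      simp [Real.zero_rpow hα.ne']
  have hle2 : ∫ s in Ico t T, (T - s) ^ (α - 1) * greenFn α lam s ≤
      (T - t) ^ α / α * greenFn α lam t := by
    rw [← hker.2, ← integral_mul_const]
    refine setIntegral_mono_on (hI.mono_set fun s hs => ⟨ht0.trans_le hs.1, hs.2⟩)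
      (hker.1.mul_const _) measurableSet_Ico fun s hs => ?_
    exact mul_le_mul_of_nonneg_left (hmax ⟨ht.1.trans hs.1, hs.2.le⟩)
      (Real.rpow_nonneg (sub_nonneg.2 hs.2.le) _)
  have hVT := greenFn_volterra hα lam hT0
  have hVt := greenFn_volterra hα lam ht0
  have hκ : (T / t) ^ (α - 1) * t ^ (α - 1) = T ^ (α - 1) := by
    rw [← Real.mul_rpow (by positivity) ht0.le, div_mul_cancel₀ _ ht0.ne']
  have hkey := mul_pos (hclose t ht.1 ht.2) hgt
  have h1 := mul_le_mul_of_nonneg_left hle1 hlam.le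
  have h2 := mul_le_mul_of_nonneg_left hle2 hlam.le
  have h3 : lam * ((T / t) ^ (α - 1) * ∫ s in Ioo 0 t, (t - s) ^ (α - 1) * greenFn α lam s) =
      (T / t) ^ (α - 1) * (t ^ (α - 1) - Real.Gamma α * greenFn α lam t) := by
    rw [← hVt]
    ring
  have h4 := mul_nonpos_of_nonneg_of_nonpos hΓ.le hgT
  rw [hsplit, mul_add] at hVT
  rw [h3, mul_sub, hκ] at h1
  linarith

lemma integrableOn_greenFn {α lam : ℝ} (hα : 0 < α) (hα1 : α < 1) (hlam : 0 < lam) :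
    IntegrableOn (greenFn α lam) (Ioi 0) := by
  refine integrableOn_Ioi_of_intervalIntegral_norm_bounded (b := fun n : ℕ => (n : ℝ) + 1)
    (l := atTop) (1 / lam) 0 (fun n => ?_)
    (tendsto_atTop_add_const_right _ _ tendsto_natCast_atTop_atTop) ?_
  · rw [integrableOn_Ioc_iff_integrableOn_Ioo]
    exact integrableOn_Ioo_greenFn hα lam (by positivity)
  · refine Eventually.of_forall fun n => ?_
    have hn : (0 : ℝ) < n + 1 := by positivity
    rw [intervalIntegral.integral_of_le hn.le, integral_Ioc_eq_integral_Ioo,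
      setIntegral_congr_fun (g := greenFn α lam) measurableSet_Ioo fun r hr =>
        Real.norm_of_nonneg (greenFn_pos hα hα1 hlam hr.1).le]
    have h1 := integral_sonine_greenFn hα hα1 lam hn
    have h2 : 0 ≤ ∫ r in Ioo 0 ((n : ℝ) + 1), ((n : ℝ) + 1 - r) ^ (-α) * greenFn α lam r :=
      setIntegral_nonneg measurableSet_Ioo fun r hr =>
        mul_nonneg (Real.rpow_nonneg (sub_nonneg.2 hr.2.le) _) (greenFn_pos hα hα1 hlam hr.1).le
    rw [h1] at h2
    have h3 := nonneg_of_mul_nonneg_right h2 (Real.Gamma_pos_of_pos (sub_pos.2 hα1))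
    rw [le_div_iff₀ hlam]
    linarith

/-- Fubini for the composition of two causal convolutions. -/
lemma integral_smul_integral_causal {g a : ℝ → ℝ} {W : ℝ → ℂ} {C : ℝ} (hgm : Measurable g)
    (ham : Measurable a) (hW : Continuous W) (hg : IntegrableOn g (Ioi 0))
    (hint : ∀ y, IntegrableOn (fun u => a u • W (y - u)) (Ioi 0))
    (hC : ∀ y, ∫ u in Ioi 0, ‖a u • W (y - u)‖ ≤ C) (x : ℝ) :
    IntegrableOn (fun w => (∫ r in Ioo 0 w, a (w - r) * g r) • W (x - w)) (Ioi 0) ∧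
    ∫ r in Ioi 0, g r • ∫ u in Ioi 0, a u • W (x - r - u) =
      ∫ w in Ioi 0, (∫ r in Ioo 0 w, a (w - r) * g r) • W (x - w) := by
  set g' : ℝ → ℝ := (Ioi 0).indicator g with hg'
  set a' : ℝ → ℝ := (Ioi 0).indicator a with ha'
  have hg'm : Measurable g' := hgm.indicator measurableSet_Ioi
  have ha'm : Measurable a' := ham.indicator measurableSet_Ioi
  have hg'i : Integrable g' := hg.integrable_indicator measurableSet_Ioi
  have ha'eq : ∀ y, (fun u => a' u • W (y - u)) = (Ioi 0).indicator fun u => a u • W (y - u) := by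
    intro y
    ext u
    by_cases hu : u ∈ Ioi (0 : ℝ) <;> simp [ha', hu]
  have hint' : ∀ y, Integrable fun u => a' u • W (y - u) := fun y => by
    rw [ha'eq]
    exact (hint y).integrable_indicator measurableSet_Ioi
  have hshift : ∀ r w, a' (w - r) • W (x - w) = a' (w - r) • W (x - r - (w - r)) := fun r w => by
    rw [sub_sub_sub_cancel_right]
  have hinner : ∀ r, ∫ w, a' (w - r) • W (x - w) = ∫ u in Ioi 0, a u • W (x - r - u) := by
    intro r
    simp_rw [hshift r]
    rw [integral_sub_right_eq_self (fun u => a' u • W (x - r - u)) r, ha'eq,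
      integral_indicator measurableSet_Ioi]
  have hinner' : ∀ r, ∫ w, ‖a' (w - r) • W (x - w)‖ ≤ C := by
    intro r
    simp_rw [hshift r]
    rw [integral_sub_right_eq_self (fun u => ‖a' u • W (x - r - u)‖) r]
    refine le_of_eq_of_le ?_ (hC (x - r))
    rw [← integral_indicator measurableSet_Ioi]
    refine integral_congr_ae (ae_of_all _ fun u => ?_)
    by_cases hu : u ∈ Ioi (0 : ℝ) <;> simp [ha', hu]
  have hC0 : 0 ≤ C := le_trans (integral_nonneg fun _ => norm_nonneg _) (hinner' 0)
  have hH : Integrable (Function.uncurry fun r w => g' r • (a' (w - r) • W (x - w)))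
      (volume.prod volume) := by
    have hmeas : AEStronglyMeasurable
        (Function.uncurry fun r w => g' r • (a' (w - r) • W (x - w))) (volume.prod volume) := by
      refine Measurable.aestronglyMeasurable ?_
      have hWm := hW.measurable
      refine (hg'm.comp measurable_fst).smul
        ((ha'm.comp (measurable_snd.sub measurable_fst)).smul
          (hWm.comp (measurable_const.sub measurable_snd)))
    refine (integrable_prod_iff hmeas).2 ⟨ae_of_all _ fun r => ?_, ?_⟩
    · simp only [Function.uncurry_apply_pair]
      refine Integrable.smul (g' r) ?_
      simp_rw [hshift r]
      exact (hint' (x - r)).comp_sub_right r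
    · refine (hg'i.norm.mul_const C).mono' hmeas.norm.integral_prod_right' (ae_of_all _ fun r => ?_)
      rw [Real.norm_of_nonneg (integral_nonneg fun _ => norm_nonneg _)]
      simp only [Function.uncurry_apply_pair]
      simp_rw [norm_smul (g' r)]
      rw [integral_const_mul]
      exact mul_le_mul_of_nonneg_left (hinner' r) (norm_nonneg _)
  have houter : ∀ w, ∫ r, g' r • (a' (w - r) • W (x - w)) =
      (∫ r in Ioo 0 w, a (w - r) * g r) • W (x - w) := by
    intro w
    simp_rw [smul_smul]
    rw [integral_smul_const, ← integral_indicator measurableSet_Ioo]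
    congr 1
    refine integral_congr_ae (ae_of_all _ fun r => ?_)
    by_cases h1 : 0 < r <;> by_cases h2 : r < w <;> simp [g', a', indicator, h1, h2, mul_comm]
  have hR := hH.integral_prod_right
  simp only [Function.uncurry_apply_pair, houter] at hR
  refine ⟨hR.integrableOn, ?_⟩
  have hswap := integral_integral_swap hH
  simp_rw [houter, integral_smul, hinner] at hswap
  rw [setIntegral_eq_integral_of_forall_compl_eq_zero (s := Ioi 0)
    (f := fun w => (∫ r in Ioo 0 w, a (w - r) * g r) • W (x - w)), ← hswap,
    ← integral_indicator measurableSet_Ioi]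
  · refine integral_congr_ae (ae_of_all _ fun r => ?_)
    by_cases h1 : 0 < r <;> simp [g', h1]
  · intro w hw
    rw [Ioo_eq_empty hw]
    simp

lemma integrableOn_Ioc_rpow_neg {α : ℝ} (hα1 : α < 1) :
    IntegrableOn (fun s : ℝ => s ^ (-α)) (Ioc 0 1) := by
  rw [← intervalIntegrable_iff_integrableOn_Ioc_of_le zero_le_one]
  exact intervalIntegral.intervalIntegrable_rpow' (by linarith)

namespace SchwartzMap

variable (V : SchwartzMap ℝ ℂ)

lemma exists_norm_deriv_le : ∃ B, 0 ≤ B ∧ ∀ y, ‖deriv V y‖ ≤ B :=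
  ⟨_, apply_nonneg _ _, fun y => by
    simpa using norm_le_seminorm ℝ (derivCLM ℝ ℂ V) y⟩

lemma norm_sub_le_of_norm_deriv_le {B : ℝ} (hB : ∀ y, ‖deriv V y‖ ≤ B) (x y : ℝ) :
    ‖V y - V x‖ ≤ B * ‖y - x‖ :=
  Convex.norm_image_sub_le_of_norm_deriv_le (f := V) (fun _ _ => V.differentiableAt)
    (fun z _ => hB z) convex_univ (mem_univ x) (mem_univ y)

lemma integrable_deriv : Integrable (deriv V) := (derivCLM ℝ ℂ V).integrable

lemma continuous_deriv_coe : Continuous (deriv V) := (derivCLM ℝ ℂ V).continuous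

lemma exists_marchaud_bound {α : ℝ} (hα : 0 < α) (hα1 : α < 1) :
    ∃ m : ℝ → ℝ, IntegrableOn m (Ioi 0) ∧
      ∀ y s, 0 < s → ‖s ^ (-(1 + α)) • (V y - V (y - s))‖ ≤ m s := by
  obtain ⟨B, hB0, hB⟩ := V.exists_norm_deriv_le
  set A := SchwartzMap.seminorm ℝ 0 0 V
  have hA : ∀ y, ‖V y‖ ≤ A := norm_le_seminorm ℝ V
  have hA0 : 0 ≤ A := apply_nonneg _ _
  refine ⟨fun s => (Ioc 0 1).indicator (fun s => B * s ^ (-α)) s +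
    (Ioi 1).indicator (fun s => 2 * A * s ^ (-(1 + α))) s, ?_, fun y s hs => ?_⟩
  · refine (Integrable.add ?_ ?_).integrableOn
    · exact IntegrableOn.integrable_indicator ((integrableOn_Ioc_rpow_neg hα1).const_mul B)
        measurableSet_Ioc
    · exact IntegrableOn.integrable_indicator
        ((integrableOn_Ioi_rpow_of_lt (by linarith) one_pos).const_mul _) measurableSet_Ioi
  · rw [norm_smul, Real.norm_of_nonneg (Real.rpow_nonneg hs.le _)]
    rcases le_or_gt s 1 with h | h
    · have h1 : ‖V y - V (y - s)‖ ≤ B * s := by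
        simpa [abs_of_pos hs] using V.norm_sub_le_of_norm_deriv_le hB (y - s) y
      have h2 : s ^ (-α) = s ^ (-(1 + α)) * s := by
        rw [← Real.rpow_add_one hs.ne']
        congr 1
        ring
      simp only [indicator, mem_Ioc, hs, h, and_self, if_true, mem_Ioi, not_lt.2 h, if_false,
        add_zero]
      rw [h2]
      calc s ^ (-(1 + α)) * ‖V y - V (y - s)‖ ≤ s ^ (-(1 + α)) * (B * s) := by gcongr
        _ = _ := by ring
    · have h1 : ‖V y - V (y - s)‖ ≤ 2 * A :=
        (norm_sub_le _ _).trans (by linarith [hA y, hA (y - s)])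
      simp only [indicator, mem_Ioc, h, not_le.2 h, and_false, if_true, mem_Ioi, if_false,
        zero_add]
      calc s ^ (-(1 + α)) * ‖V y - V (y - s)‖ ≤ s ^ (-(1 + α)) * (2 * A) := by gcongr
        _ = _ := by ring

lemma exists_bound_rpow_smul_deriv {α : ℝ} (hα : 0 < α) (hα1 : α < 1) :
    ∃ C, ∀ y, IntegrableOn (fun u => u ^ (-α) • deriv V (y - u)) (Ioi 0) ∧
      ∫ u in Ioi 0, ‖u ^ (-α) • deriv V (y - u)‖ ≤ C := by
  obtain ⟨B, hB0, hB⟩ := V.exists_norm_deriv_le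
  have hm1 : Integrable ((Ioc (0 : ℝ) 1).indicator fun s => B * s ^ (-α)) :=
    IntegrableOn.integrable_indicator ((integrableOn_Ioc_rpow_neg hα1).const_mul B)
      measurableSet_Ioc
  have hm2 : ∀ y, Integrable fun u => ‖deriv V (y - u)‖ := fun y =>
    (V.integrable_deriv.comp_sub_left y).norm
  have hbd : ∀ y, ∀ u ∈ Ioi (0 : ℝ), ‖u ^ (-α) • deriv V (y - u)‖ ≤
      (Ioc (0 : ℝ) 1).indicator (fun s => B * s ^ (-α)) u + ‖deriv V (y - u)‖ := by
    intro y u hu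
    have hu : 0 < u := hu
    rw [norm_smul, Real.norm_of_nonneg (Real.rpow_nonneg hu.le _)]
    rcases le_or_gt u 1 with h | h
    · simp only [indicator, mem_Ioc, hu, h, and_self, if_true]
      have := mul_le_mul_of_nonneg_left (hB (y - u)) (Real.rpow_nonneg hu.le (-α))
      nlinarith [norm_nonneg (deriv V (y - u))]
    · simp only [indicator, mem_Ioc, not_le.2 h, and_false, if_false, zero_add]
      exact mul_le_of_le_one_left (norm_nonneg _)
        (Real.rpow_le_one_of_one_le_of_nonpos h.le (by linarith))
  have hint : ∀ y, IntegrableOn (fun u => u ^ (-α) • deriv V (y - u)) (Ioi 0) := by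
    intro y
    refine ((hm1.add (hm2 y)).integrableOn).mono' (Measurable.aestronglyMeasurable ?_) ?_
    · exact (measurable_id.pow_const _).smul
        (V.continuous_deriv_coe.measurable.comp (measurable_const.sub measurable_id))
    · filter_upwards [ae_restrict_mem measurableSet_Ioi] with u hu using hbd y u hu
  refine ⟨(∫ u, (Ioc (0 : ℝ) 1).indicator (fun s => B * s ^ (-α)) u) + ∫ u, ‖deriv V u‖,
    fun y => ⟨hint y, ?_⟩⟩
  rw [← integral_sub_left_eq_self (fun u => ‖deriv V u‖) volume y, ← integral_add hm1 (hm2 y)]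
  refine (setIntegral_mono_on (hint y).norm (hm1.add (hm2 y)).integrableOn measurableSet_Ioi
    (hbd y)).trans (setIntegral_le_integral (hm1.add (hm2 y)) (ae_of_all _ fun u => ?_))
  refine add_nonneg (indicator_nonneg (fun s hs => ?_) u) (norm_nonneg _)
  exact mul_nonneg hB0 (Real.rpow_nonneg hs.1.le _)

lemma tendsto_sub_atTop (y : ℝ) : Tendsto (fun s => V (y - s)) atTop (nhds 0) := by
  refine V.tendsto_cocompact.comp (Tendsto.mono_right ?_ atBot_le_cocompact)
  exact tendsto_atBot_add_const_left _ y tendsto_neg_atTop_atBot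

lemma hasDerivAt_const_sub (y s : ℝ) :
    HasDerivAt (fun s => V (y - s)) (-deriv V (y - s)) s := by
  refine ((V.differentiableAt (x := y - s)).hasDerivAt.scomp s
    ((hasDerivAt_id s).const_sub y)).congr_deriv ?_
  simp

lemma integral_Ioi_deriv_sub (y : ℝ) : ∫ u in Ioi 0, deriv V (y - u) = V y := by
  have h := integral_Ioi_of_hasDerivAt_of_tendsto' (a := 0)
    (fun s _ => V.hasDerivAt_const_sub y s)
    ((V.integrable_deriv.comp_sub_left y).neg.integrableOn) (V.tendsto_sub_atTop y)
  rw [integral_neg] at h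
  simpa using h

/-- The Marchaud derivative of a Schwartz function in Caputo form. -/
lemma integral_marchaud {α : ℝ} (hα : 0 < α) (hα1 : α < 1) (y : ℝ) :
    ∫ s in Ioi 0, s ^ (-(1 + α)) • (V y - V (y - s)) =
      α⁻¹ • ∫ u in Ioi 0, u ^ (-α) • deriv V (y - u) := by
  obtain ⟨m, hm, hbd⟩ := V.exists_marchaud_bound hα hα1
  obtain ⟨C, hC⟩ := V.exists_bound_rpow_smul_deriv hα hα1
  obtain ⟨B, hB0, hB⟩ := V.exists_norm_deriv_le
  have hi1 : IntegrableOn (fun s => s ^ (-(1 + α)) • (V y - V (y - s))) (Ioi 0) := by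
    refine hm.mono' (Measurable.aestronglyMeasurable ?_) ?_
    · exact (measurable_id.pow_const _).smul (measurable_const.sub
        (V.continuous.measurable.comp (measurable_const.sub measurable_id)))
    · filter_upwards [ae_restrict_mem measurableSet_Ioi] with u hu using hbd y u hu
  have hi2 := (hC y).1
  have hi3 : IntegrableOn (fun s => α • (s ^ (-(1 + α)) • (V y - V (y - s)))) (Ioi 0) :=
    hi1.smul α
  have hderiv : ∀ s ∈ Ioi (0 : ℝ), HasDerivAt (fun s => s ^ (-α) • (V y - V (y - s)))
      (s ^ (-α) • deriv V (y - s) - α • (s ^ (-(1 + α)) • (V y - V (y - s)))) s := by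
    intro s hs
    have h1 := (Real.hasDerivAt_rpow_const (x := s) (p := -α) (Or.inl (ne_of_gt hs)))
    have h2 := h1.smul ((V.hasDerivAt_const_sub y s).const_sub (V y))
    refine h2.congr_deriv ?_
    rw [show -(1 + α) = -α - 1 by ring, neg_neg, smul_smul, neg_mul, neg_smul, ← sub_eq_add_neg]
  have hcont : ContinuousWithinAt (fun s => s ^ (-α) • (V y - V (y - s))) (Ici 0) 0 := by
    have hlim : Tendsto (fun s : ℝ => B * s ^ (1 - α)) (nhdsWithin 0 (Ici 0)) (nhds 0) := by
      have := ((Real.continuous_rpow_const (q := 1 - α) (by linarith)).const_mul B).tendsto 0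
      simp only [Real.zero_rpow (sub_pos.2 hα1).ne', mul_zero] at this
      exact this.mono_left nhdsWithin_le_nhds
    rw [ContinuousWithinAt]
    simp only [sub_zero, sub_self, smul_zero]
    refine squeeze_zero_norm' ?_ hlim
    filter_upwards [self_mem_nhdsWithin] with s hs
    have h1 : ‖V y - V (y - s)‖ ≤ B * s := by
      simpa [abs_of_nonneg hs.out] using V.norm_sub_le_of_norm_deriv_le hB (y - s) y
    rw [norm_smul, Real.norm_of_nonneg (Real.rpow_nonneg hs _)]
    rcases eq_or_lt_of_le hs.out with h0 | h0
    · simp [← h0, Real.zero_rpow (sub_pos.2 hα1).ne']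
    · calc s ^ (-α) * ‖V y - V (y - s)‖ ≤ s ^ (-α) * (B * s) := by gcongr
        _ = B * s ^ (1 - α) := by
          rw [show 1 - α = -α + 1 by ring, Real.rpow_add_one h0.ne']
          ring
  have htop : Tendsto (fun s => s ^ (-α) • (V y - V (y - s))) atTop (nhds 0) := by
    have := (tendsto_rpow_neg_atTop hα).smul ((V.tendsto_sub_atTop y).const_sub (V y))
    simpa using this
  have h := integral_Ioi_of_hasDerivAt_of_tendsto hcont hderiv (hi2.sub hi3) htop
  rw [integral_sub hi2 hi3, integral_smul] at h
  simp only [sub_zero, sub_self, smul_zero] at h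
  rw [sub_eq_zero.1 h, smul_smul, inv_mul_cancel₀ hα.ne', one_smul]

end SchwartzMap

/-- The convolution of the Green's function with a Schwartz function solves the fractional
relaxation equation. -/
lemma marchaud_greenFn_convolution {α lam : ℝ} (hα : 0 < α) (hα1 : α < 1) (hlam : 0 < lam)
    (V : SchwartzMap ℝ ℂ) (S : ℝ → ℂ)
    (hS : ∀ x, S x = ∫ r in Ioi 0, greenFn α lam r • V (x - r)) (x : ℝ) :
    (α / Real.Gamma (1 - α)) • (∫ s in Ioi 0, s ^ (-(1 + α)) • (S x - S (x - s))) + lam • S x =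
      V x := by
  obtain ⟨m, hm, hbd⟩ := V.exists_marchaud_bound hα hα1
  obtain ⟨C, hC⟩ := V.exists_bound_rpow_smul_deriv hα hα1
  have hg := integrableOn_greenFn hα hα1 hlam
  have hgm := measurable_greenFn hα lam
  have hgV : ∀ x, IntegrableOn (fun r => greenFn α lam r • V (x - r)) (Ioi 0) := fun x =>
    hg.smul_bdd (SchwartzMap.seminorm ℝ 0 0 V)
      (V.continuous.comp (continuous_const.sub continuous_id)).aestronglyMeasurable
      (ae_of_all _ fun r => V.norm_le_seminorm ℝ (x - r))
  have hdiff : ∀ s, s ^ (-(1 + α)) • (S x - S (x - s)) = ∫ r in Ioi 0,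
      greenFn α lam r • (s ^ (-(1 + α)) • (V (x - r) - V (x - r - s))) := by
    intro s
    rw [hS, hS, ← integral_sub (hgV _) (hgV _), ← integral_smul]
    refine integral_congr_ae (ae_of_all _ fun r => ?_)
    simp only
    rw [← smul_sub, smul_comm, sub_right_comm x s r]
  have hprod : Integrable (Function.uncurry fun s r =>
      greenFn α lam r • (s ^ (-(1 + α)) • (V (x - r) - V (x - r - s))))
      ((volume.restrict (Ioi 0)).prod (volume.restrict (Ioi 0))) := by
    refine (Integrable.mul_prod hm hg.norm).mono' (Measurable.aestronglyMeasurable ?_) ?_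
    · have hVm := V.continuous.measurable
      exact (hgm.comp measurable_snd).smul ((measurable_fst.pow_const _).smul
        ((hVm.comp (measurable_const.sub measurable_snd)).sub
          (hVm.comp ((measurable_const.sub measurable_snd).sub measurable_fst))))
    · rw [Measure.prod_restrict]
      filter_upwards [ae_restrict_mem (measurableSet_Ioi.prod measurableSet_Ioi)] with p hp
      rw [Function.uncurry, norm_smul, mul_comm]
      exact mul_le_mul_of_nonneg_right (hbd (x - p.2) p.1 hp.1) (norm_nonneg _)
  have hF := (integral_smul_integral_causal hgm (measurable_id.pow_const (-α)) V.continuous_deriv_coe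
    hg (fun y => (hC y).1) (fun y => (hC y).2) x).2
  obtain ⟨hGi, hG⟩ := integral_smul_integral_causal (a := fun _ => 1) (C := ∫ u, ‖deriv V u‖) hgm
    measurable_const V.continuous_deriv_coe hg
    (fun y => by simpa using (V.integrable_deriv.comp_sub_left y).integrableOn)
    (fun y => by
      simp only [one_smul]
      rw [← integral_sub_left_eq_self (fun u => ‖deriv V u‖) volume y]
      exact setIntegral_le_integral (V.integrable_deriv.comp_sub_left y).norm
        (ae_of_all _ fun u => norm_nonneg _)) x
  simp only [one_smul, one_mul, V.integral_Ioi_deriv_sub] at hG hGi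
  have hVi : IntegrableOn (fun w => deriv V (x - w)) (Ioi 0) :=
    (V.integrable_deriv.comp_sub_left x).integrableOn
  have hGi' : IntegrableOn (fun w => lam • ((∫ r in Ioo 0 w, greenFn α lam r) •
      deriv V (x - w))) (Ioi 0) := hGi.smul lam
  have hΓ := (Real.Gamma_pos_of_pos (sub_pos.2 hα1)).ne'
  have hmain : ∫ s in Ioi 0, s ^ (-(1 + α)) • (S x - S (x - s)) =
      (α⁻¹ * Real.Gamma (1 - α)) • (V x - lam • S x) := by
    simp_rw [hdiff]
    rw [integral_integral_swap hprod]
    simp_rw [integral_smul, V.integral_marchaud hα hα1, smul_comm _ α⁻¹]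
    simp only [id] at hF
    rw [integral_smul, hF, hS x, hG, ← V.integral_Ioi_deriv_sub x, ← integral_smul lam,
      ← integral_sub hVi hGi', mul_smul, ← integral_smul (Real.Gamma (1 - α))]
    congr 1
    refine setIntegral_congr_fun measurableSet_Ioi fun w hw => ?_
    rw [integral_sonine_greenFn hα hα1 lam hw, mul_smul, sub_smul, one_smul, mul_smul]
  rw [hmain, smul_smul, show α / Real.Gamma (1 - α) * (α⁻¹ * Real.Gamma (1 - α)) = 1 by field_simp,
    one_smul, sub_add_cancel]

/-- The substitution `r = ψ t - ψ τ`. -/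
lemma integral_Iio_comp_sub_s3 {ψ ψ' : ℝ → ℝ} (hψmono : StrictMono ψ)
    (hψderiv : ∀ t, HasDerivAt ψ (ψ' t) t) (hψ'pos : ∀ t, 0 < ψ' t)
    (hψbot : Tendsto ψ atBot atBot) (F : ℝ → ℂ) (t : ℝ) :
    ∫ τ in Iio t, ψ' τ • F (ψ t - ψ τ) = ∫ r in Ioi 0, F r := by
  have himage : (fun τ => ψ t - ψ τ) '' Iio t = Ioi 0 := by
    ext r
    constructor
    · rintro ⟨τ, hτ, rfl⟩
      exact sub_pos.2 (hψmono hτ)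
    · intro hr
      have hcont : Continuous ψ := continuous_iff_continuousAt.2 fun τ => (hψderiv τ).continuousAt
      obtain ⟨a, ha⟩ := (hψbot.eventually (eventually_le_atBot (ψ t - r))).exists
      have hat : a ≤ t := hψmono.le_iff_le.1 (ha.trans (sub_le_self _ (le_of_lt hr)))
      obtain ⟨τ, -, hτ⟩ := intermediate_value_Icc hat hcont.continuousOn
        ⟨ha, sub_le_self _ (le_of_lt hr)⟩
      refine ⟨τ, hψmono.lt_iff_lt.1 ?_, by simp [hτ]⟩
      rw [hτ]
      exact sub_lt_self _ hr
  rw [← himage, integral_image_eq_integral_abs_deriv_smul measurableSet_Iio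
    (fun τ _ => ((hψderiv τ).const_sub (ψ t)).hasDerivWithinAt)
    (fun a _ b _ hab => hψmono.injective (sub_right_injective hab))]
  simp only [abs_neg, abs_of_pos (hψ'pos _)]

theorem stmt_3
    (ψ ψ' ω : ℝ → ℝ)
    (hψmono : StrictMono ψ)
    (hψderiv : ∀ t, HasDerivAt ψ (ψ' t) t)
    (hψ'cont : Continuous ψ')
    (hψ'pos : ∀ t, 0 < ψ' t)
    (hψtop : Tendsto ψ atTop atTop)
    (hψbot : Tendsto ψ atBot atBot)
    (hωmeas : Measurable ω)
    (hωpos : ∀ t, 0 < ω t)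
    (hωloc : ∀ K : Set ℝ, IsCompact K → ∃ C > 0, ∀ t ∈ K, ω t ≤ C ∧ C⁻¹ ≤ ω t)
    (α lam : ℝ) (hα : 0 < α) (hα1 : α < 1) (hlam : 0 < lam)
    (f : ℝ → ℂ)
    (V : SchwartzMap ℝ ℂ)
    (hV : ∀ y : ℝ, V y = (ω (Function.invFun ψ y) : ℂ) * f (Function.invFun ψ y)) :
    ∀ᵐ t : ℝ,
      wD α ψ ψ' ω (sigmaSol α lam ψ ψ' ω f) t + (lam : ℂ) * sigmaSol α lam ψ ψ' ω f t = f t := by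
  set S : ℝ → ℂ := fun x => ∫ r in Ioi 0, greenFn α lam r • V (x - r) with hS
  have hVψ : ∀ τ, V (ψ τ) = (ω τ : ℂ) * f τ := fun τ => by
    rw [hV, Function.leftInverse_invFun hψmono.injective τ]
  have hω : ∀ t, (ω t : ℂ) ≠ 0 := fun t => by exact_mod_cast (hωpos t).ne'
  have hσ : ∀ t, (ω t : ℂ) * sigmaSol α lam ψ ψ' ω f t = S (ψ t) := fun t => by
    rw [sigmaSol, mul_inv_cancel_left₀ (hω t), hS]
    simp only
    rw [← integral_Iio_comp_sub_s3 hψmono hψderiv hψ'pos hψbot _ t]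
    refine integral_congr_ae (ae_of_all _ fun τ => ?_)
    simp only [sub_sub_cancel, hVψ, greenFn, Complex.real_smul]
    push_cast
    ring
  refine ae_of_all _ fun t => mul_left_cancel₀ (hω t) ?_
  have hD : (ω t : ℂ) * wD α ψ ψ' ω (sigmaSol α lam ψ ψ' ω f) t =
      (α / Real.Gamma (1 - α)) •
        ∫ s in Ioi 0, s ^ (-(1 + α)) • (S (ψ t) - S (ψ t - s)) := by
    rw [wD, ← integral_Iio_comp_sub_s3 hψmono hψderiv hψ'pos hψbot _ t, ← mul_assoc,
      Complex.real_smul]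
    congr 1
    · push_cast
      rw [mul_div_cancel₀ _ (hω t)]
    · refine integral_congr_ae (ae_of_all _ fun τ => ?_)
      simp only [hσ, sub_sub_cancel, Complex.real_smul]
      push_cast
      ring
  rw [mul_add, hD, mul_left_comm, hσ, ← hVψ, ← Complex.real_smul]
  exact marchaud_greenFn_convolution hα hα1 hlam V S (fun _ => rfl) (ψ t)
end
end

section
/- Let 0 < α < 1 and let u : ℝ → ℂ be such that v(y) := ω(ψ⁻¹(y)) u(ψ⁻¹(y)) belongs to the Schwartz space 𝓢(ℝ). Then the weighted Fourier transform diagonalizes the weighted Weyl–Marchaud derivative: for every ξ ∈ ℝ, (2π)^{-1/2} ∫_ℝ (𝔇^α_{ψ,ω}u)(t) e^{−iξψ(t)} ω(t) ψ'(t) dt = (iξ)^α · û_{ψ,ω}(ξ), where 𝔇^α_{ψ,ω}u(t) := (c_α/ω(t)) ∫_{-∞}^t (ω(t)u(t) − ω(τ)u(τ)) (ψ(t) − ψ(τ))^{−1−α} ψ'(τ) dτ with c_α = α/Γ(1−α), and (iξ)^α = |ξ|^α e^{iαπ·sgn(ξ)/2} is the principal branch. -/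
open MeasureTheory Set Filter

noncomputable section

/-- The symmetric weighted Fourier transform. -/
def wFT (ψ ψ' ω : ℝ → ℝ) (f : ℝ → ℂ) (ξ : ℝ) : ℂ :=
  (Real.sqrt (2 * Real.pi) : ℂ)⁻¹ *
    ∫ t : ℝ, f t * Complex.exp (-(Complex.I * (ξ : ℂ) * (ψ t : ℂ))) * ((ω t * ψ' t : ℝ) : ℂ)

lemma integrableOn_rpow_mul_exp_neg_mul {a b : ℝ} (ha : -1 < a) (hb : 0 < b) :
    IntegrableOn (fun r : ℝ => r ^ a * Real.exp (-(b * r))) (Ioi 0) := by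
  simpa using integrableOn_rpow_mul_exp_neg_mul_rpow ha zero_lt_one hb

lemma hasDerivAt_integral_rpow_mul_exp_neg_mul {a : ℝ} (ha : -1 < a) {z : ℂ} (hz : 0 < z.re) :
    HasDerivAt
      (fun z : ℂ => ∫ r in Ioi (0 : ℝ), ((r ^ a : ℝ) : ℂ) * Complex.exp (-(z * r)))
      (∫ r in Ioi (0 : ℝ), ((r ^ a : ℝ) : ℂ) * (-r * Complex.exp (-(z * r)))) z := by
  have hmeas : ∀ w : ℂ, AEStronglyMeasurable
      (fun r : ℝ => ((r ^ a : ℝ) : ℂ) * Complex.exp (-(w * r))) (volume.restrict (Ioi 0)) :=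
    fun w => (Measurable.mul (by fun_prop) (by fun_prop)).aestronglyMeasurable
  refine (hasDerivAt_integral_of_dominated_loc_of_deriv_le
    (bound := fun r => r ^ (a + 1) * Real.exp (-(z.re / 2 * r)))
    (F' := fun w r => ((r ^ a : ℝ) : ℂ) * (-r * Complex.exp (-(w * r))))
    (Metric.ball_mem_nhds z (half_pos hz)) (Eventually.of_forall hmeas) ?_ ?_ ?_ ?_ ?_).2
  · refine (integrableOn_rpow_mul_exp_neg_mul ha hz).mono' (hmeas z) ?_
    refine (ae_restrict_iff' measurableSet_Ioi).2 (Eventually.of_forall fun r hr => le_of_eq ?_)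
    rw [norm_mul, Complex.norm_real, Complex.norm_exp,
      Real.norm_of_nonneg (Real.rpow_nonneg (le_of_lt hr) _)]
    simp
  · exact (Measurable.mul (by fun_prop) (by fun_prop)).aestronglyMeasurable
  · refine (ae_restrict_iff' measurableSet_Ioi).2 (Eventually.of_forall fun r hr w hw => ?_)
    have hr' : 0 < r := hr
    have hre : z.re / 2 ≤ w.re := by
      have h1 := (Complex.abs_re_le_norm (w - z)).trans (mem_ball_iff_norm.1 hw).le
      rw [Complex.sub_re] at h1
      linarith [(abs_le.1 h1).1]
    rw [norm_mul, norm_mul, norm_neg, Complex.norm_real, Complex.norm_real, Complex.norm_exp,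
      Real.norm_of_nonneg (Real.rpow_nonneg hr'.le _), Real.norm_of_nonneg hr'.le, ← mul_assoc,
      Real.rpow_add_one hr'.ne']
    have : (-(w * (r : ℂ))).re = -(w.re * r) := by simp
    rw [this]
    gcongr
  · exact integrableOn_rpow_mul_exp_neg_mul (by linarith) (half_pos hz)
  · refine Eventually.of_forall fun r w _ => ?_
    have h := (((hasDerivAt_id w).mul_const (r : ℂ)).fun_neg.cexp).const_mul ((r ^ a : ℝ) : ℂ)
    simp only [id, one_mul] at h
    refine h.congr_deriv ?_
    ring

lemma integral_rpow_mul_cexp_neg_mul_Ioi {a : ℝ} (ha : -1 < a) {z : ℂ} (hz : 0 < z.re) :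
    ∫ r in Ioi (0 : ℝ), ((r ^ a : ℝ) : ℂ) * Complex.exp (-(z * r)) =
      (Real.Gamma (a + 1) : ℂ) * z ^ (-(a + 1) : ℂ) := by
  have hopen : IsOpen {z : ℂ | 0 < z.re} := isOpen_lt continuous_const Complex.continuous_re
  have hf : AnalyticOnNhd ℂ
      (fun z : ℂ => ∫ r in Ioi (0 : ℝ), ((r ^ a : ℝ) : ℂ) * Complex.exp (-(z * r)))
      {z : ℂ | 0 < z.re} :=
    DifferentiableOn.analyticOnNhd (fun w hw =>
      (hasDerivAt_integral_rpow_mul_exp_neg_mul ha hw).differentiableAt.differentiableWithinAt)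
      hopen
  have hg : AnalyticOnNhd ℂ (fun z : ℂ => (Real.Gamma (a + 1) : ℂ) * z ^ (-(a + 1) : ℂ))
      {z : ℂ | 0 < z.re} :=
    DifferentiableOn.analyticOnNhd (fun w hw =>
      ((differentiableAt_id.cpow_const (Or.inl hw)).const_mul _).differentiableWithinAt) hopen
  refine hf.eqOn_of_preconnected_of_frequently_eq hg
    (convex_halfSpace_re_gt 0).isPreconnected (z₀ := 1) (by simp) ?_ hz
  have ht : Tendsto (fun x : ℝ => (x : ℂ)) (nhdsWithin 1 {1}ᶜ) (nhdsWithin 1 {1}ᶜ) := by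
    refine tendsto_nhdsWithin_iff.2 ⟨?_, ?_⟩
    · simpa using (Complex.continuous_ofReal.tendsto 1).mono_left nhdsWithin_le_nhds
    · filter_upwards [self_mem_nhdsWithin] with x hx
      simpa using hx
  refine ht.frequently (Eventually.frequently ?_)
  filter_upwards [mem_nhdsWithin_of_mem_nhds (Ioi_mem_nhds zero_lt_one)] with x hx
  have hx' : 0 < x := hx
  have h := Real.integral_rpow_mul_exp_neg_mul_Ioi (a := a + 1) (by linarith) hx'
  rw [add_sub_cancel_right, one_div, Real.inv_rpow hx'.le, ← Real.rpow_neg hx'.le] at h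
  have h2 := congrArg (fun y : ℝ => (y : ℂ)) h
  simp only [← integral_complex_ofReal, Complex.ofReal_mul, Complex.ofReal_exp,
    Complex.ofReal_neg] at h2
  rw [h2, mul_comm, Complex.ofReal_cpow hx'.le]
  push_cast
  rfl

lemma integrableOn_min_one_mul_rpow {α : ℝ} (hα : 0 < α) (hα1 : α < 1) :
    IntegrableOn (fun r : ℝ => min 1 r * r ^ (-(1 + α))) (Ioi 0) := by
  rw [← Ioc_union_Ioi_eq_Ioi zero_le_one]
  refine IntegrableOn.union ?_ ?_
  · have h : IntegrableOn (fun r : ℝ => r ^ (-α)) (Ioc 0 1) := by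
      rw [← intervalIntegrable_iff_integrableOn_Ioc_of_le zero_le_one]
      exact intervalIntegral.intervalIntegrable_rpow' (by linarith)
    refine h.congr_fun (fun r hr => ?_) measurableSet_Ioc
    simp only [min_eq_right hr.2]
    rw [← Real.rpow_one_add' hr.1.le (by linarith)]
    congr 1; ring
  · refine (integrableOn_Ioi_rpow_of_lt (a := -(1 + α)) (by linarith) zero_lt_one).congr_fun
      (fun r hr => ?_) measurableSet_Ioi
    simp only [min_eq_left (le_of_lt (mem_Ioi.1 hr)), one_mul]

lemma norm_one_sub_exp_neg_le {w : ℂ} (hw : 0 ≤ w.re) :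
    ‖1 - Complex.exp (-w)‖ ≤ 2 * min 1 ‖w‖ := by
  have h2 : ‖1 - Complex.exp (-w)‖ ≤ 2 := by
    refine (norm_sub_le _ _).trans ?_
    rw [norm_one, Complex.norm_exp, Complex.neg_re]
    linarith [Real.exp_le_one_iff.2 (neg_nonpos.2 hw)]
  rcases le_total ‖w‖ 1 with h | h
  · rw [min_eq_right h, norm_sub_rev]
    simpa using Complex.norm_exp_sub_one_le (x := -w) (by simpa using h)
  · rw [min_eq_left h]; linarith

lemma norm_one_sub_exp_neg_mul_le {z : ℂ} (hz : 0 ≤ z.re) {r : ℝ} (hr : 0 ≤ r) :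
    ‖1 - Complex.exp (-(z * r))‖ ≤ 2 * max 1 ‖z‖ * min 1 r := by
  refine (norm_one_sub_exp_neg_le (by simpa using mul_nonneg hz hr)).trans ?_
  rw [mul_assoc, norm_mul, Complex.norm_real, Real.norm_of_nonneg hr]
  gcongr
  have h1 := le_max_left 1 ‖z‖
  have h2 := le_max_right 1 ‖z‖
  rcases le_total r 1 with h | h
  · rw [min_eq_right h]
    exact (min_le_right _ _).trans (by gcongr)
  · rw [min_eq_left h]
    exact (min_le_left _ _).trans (by simp)

lemma integral_one_sub_exp_neg_mul_rpow_of_re_pos {α : ℝ} (hα : 0 < α) (hα1 : α < 1) {z : ℂ}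
    (hz : 0 < z.re) :
    ∫ r in Ioi (0 : ℝ), (1 - Complex.exp (-(z * r))) * ((r ^ (-(1 + α)) : ℝ) : ℂ) =
      ((Real.Gamma (1 - α) / α : ℝ) : ℂ) * z ^ (α : ℂ) := by
  have hz0 : z ≠ 0 := fun h => by simp [h] at hz
  have hu : ∀ r ∈ Ioi (0 : ℝ), HasDerivAt (fun r : ℝ => 1 - Complex.exp (-(z * r)))
      (z * Complex.exp (-(z * r))) r := fun r _ => by
    have h := (((hasDerivAt_id (r : ℂ)).const_mul z).fun_neg.cexp.const_sub 1).comp_ofReal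
    simp only [id, mul_one] at h
    refine h.congr_deriv ?_
    ring
  have hv : ∀ r ∈ Ioi (0 : ℝ), HasDerivAt (fun r : ℝ => ((-(r ^ (-α)) / α : ℝ) : ℂ))
      ((r ^ (-(1 + α)) : ℝ) : ℂ) r := fun r hr => by
    have h := ((Real.hasDerivAt_rpow_const (p := -α) (Or.inl (ne_of_gt hr))).fun_neg.div_const α)
    refine h.ofReal_comp.congr_deriv (congrArg _ ?_)
    rw [show -(1 + α) = -α - 1 by ring]
    field_simp
  have hbound : ∀ r ∈ Ioi (0 : ℝ),
      ‖(1 - Complex.exp (-(z * r))) * ((-(r ^ (-α)) / α : ℝ) : ℂ)‖ ≤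
        2 * max 1 ‖z‖ / α * (min 1 r * r ^ (-α)) := fun r hr => by
    have hr' : 0 < r := hr
    have := norm_one_sub_exp_neg_mul_le hz.le hr'.le
    have hp := Real.rpow_nonneg hr'.le (-α)
    rw [norm_mul, Complex.norm_real, norm_div, norm_neg, Real.norm_of_nonneg hp,
      Real.norm_of_nonneg hα.le]
    calc _ ≤ 2 * max 1 ‖z‖ * min 1 r * (r ^ (-α) / α) := by gcongr
      _ = _ := by ring
  have hmeas : Continuous fun r : ℝ => 1 - Complex.exp (-(z * r)) := by fun_prop
  have hint : IntegrableOn ((fun r : ℝ => 1 - Complex.exp (-(z * r))) *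
      fun r : ℝ => ((r ^ (-(1 + α)) : ℝ) : ℂ)) (Ioi 0) := by
    refine Integrable.mono' ((integrableOn_min_one_mul_rpow hα hα1).const_mul (2 * max 1 ‖z‖))
      ?_ ?_
    · exact (hmeas.measurable.mul (by fun_prop)).aestronglyMeasurable
    · refine (ae_restrict_iff' measurableSet_Ioi).2 (Eventually.of_forall fun r hr => ?_)
      have hr' : 0 < r := hr
      have := norm_one_sub_exp_neg_mul_le hz.le hr'.le
      have hp := Real.rpow_nonneg hr'.le (-(1 + α))
      rw [Pi.mul_apply, norm_mul, Complex.norm_real, Real.norm_of_nonneg hp, ← mul_assoc]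
      gcongr
  have hint' : IntegrableOn ((fun r : ℝ => z * Complex.exp (-(z * r))) *
      fun r : ℝ => ((-(r ^ (-α)) / α : ℝ) : ℂ)) (Ioi 0) := by
    refine Integrable.mono' ((integrableOn_rpow_mul_exp_neg_mul_rpow (s := -α) (by linarith)
      zero_lt_one hz).const_mul (‖z‖ / α)) ?_ ?_
    · exact (Measurable.mul (by fun_prop) (by fun_prop)).aestronglyMeasurable
    · refine (ae_restrict_iff' measurableSet_Ioi).2 (Eventually.of_forall fun r hr => le_of_eq ?_)
      have hp := Real.rpow_nonneg (le_of_lt (mem_Ioi.1 hr)) (-α)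
      rw [Pi.mul_apply, norm_mul, norm_mul, Complex.norm_exp, Complex.norm_real, norm_div,
        norm_neg, Real.norm_of_nonneg hp, Real.norm_of_nonneg hα.le]
      simp
      ring
  have h0 : Tendsto ((fun r : ℝ => 1 - Complex.exp (-(z * r))) *
      fun r : ℝ => ((-(r ^ (-α)) / α : ℝ) : ℂ)) (nhdsWithin 0 (Ioi 0)) (nhds 0) := by
    refine squeeze_zero_norm' (a := fun r => 2 * max 1 ‖z‖ / α * r ^ (1 - α)) ?_ ?_
    · filter_upwards [self_mem_nhdsWithin] with r hr
      refine (hbound r hr).trans ?_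
      have hr' : 0 < r := hr
      rw [Real.rpow_sub hr', Real.rpow_one, div_eq_mul_inv r, ← Real.rpow_neg hr'.le]
      gcongr
      exact min_le_right _ _
    · have h : Tendsto (fun r : ℝ => r ^ (1 - α)) (nhds 0) (nhds (0 ^ (1 - α))) :=
        Real.continuousAt_rpow_const _ _ (Or.inr (by linarith))
      rw [Real.zero_rpow (by linarith)] at h
      simpa using (h.mono_left nhdsWithin_le_nhds).const_mul (2 * max 1 ‖z‖ / α)
  have hinf : Tendsto ((fun r : ℝ => 1 - Complex.exp (-(z * r))) *
      fun r : ℝ => ((-(r ^ (-α)) / α : ℝ) : ℂ)) atTop (nhds 0) := by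
    refine squeeze_zero_norm' (a := fun r => 2 * max 1 ‖z‖ / α * r ^ (-α)) ?_ ?_
    · filter_upwards [Ioi_mem_atTop 0] with r hr
      refine (hbound r hr).trans ?_
      have hp := Real.rpow_nonneg (le_of_lt (mem_Ioi.1 hr)) (-α)
      gcongr
      exact mul_le_of_le_one_left hp (min_le_left _ _)
    · simpa using (tendsto_rpow_neg_atTop hα).const_mul (2 * max 1 ‖z‖ / α)
  rw [integral_Ioi_mul_deriv_eq_deriv_mul hu hv hint hint' h0 hinf]
  have hE : ∫ r in Ioi (0 : ℝ), z * Complex.exp (-(z * r)) * ((-(r ^ (-α)) / α : ℝ) : ℂ) =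
      ∫ r in Ioi (0 : ℝ), -(z / α) * (((r ^ (-α) : ℝ) : ℂ) * Complex.exp (-(z * r))) := by
    congr 1 with r
    push_cast
    ring
  rw [hE, integral_const_mul, integral_rpow_mul_cexp_neg_mul_Ioi (by linarith) hz,
    show (-(((-α : ℝ) : ℂ) + 1)) = (α : ℂ) - 1 by push_cast; ring, Complex.cpow_sub _ _ hz0,
    Complex.cpow_one, show -α + 1 = 1 - α by ring]
  push_cast
  field_simp
  ring

lemma integral_one_sub_exp_neg_I_mul_rpow {α : ℝ} (hα : 0 < α) (hα1 : α < 1) (ξ : ℝ) :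
    ∫ r in Ioi (0 : ℝ), (1 - Complex.exp (-(Complex.I * ξ * r))) * ((r ^ (-(1 + α)) : ℝ) : ℂ) =
      ((Real.Gamma (1 - α) / α : ℝ) : ℂ) * (Complex.I * ξ) ^ (α : ℂ) := by
  have hz : Tendsto (fun ε : ℝ => (ε : ℂ) + Complex.I * ξ) (nhdsWithin 0 (Ioi 0))
      (nhds (Complex.I * ξ)) := by
    have : Continuous fun ε : ℝ => (ε : ℂ) + Complex.I * ξ := by fun_prop
    simpa using (this.tendsto 0).mono_left nhdsWithin_le_nhds
  have hR := (((Complex.continuousAt_cpow_const_of_re_pos (z := Complex.I * ξ) (w := (α : ℂ))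
    (by simp) (by simpa using hα)).tendsto.comp hz).const_mul
    ((Real.Gamma (1 - α) / α : ℝ) : ℂ))
  refine tendsto_nhds_unique ?_ (hR.congr' (f₂ := fun ε : ℝ => ∫ r in Ioi (0 : ℝ),
    (1 - Complex.exp (-(((ε : ℂ) + Complex.I * ξ) * r))) * ((r ^ (-(1 + α)) : ℝ) : ℂ)) ?_)
  · refine tendsto_integral_filter_of_dominated_convergence
      (fun r => 2 * (1 + |ξ|) * (min 1 r * r ^ (-(1 + α)))) ?_ ?_
      ((integrableOn_min_one_mul_rpow hα hα1).const_mul _) ?_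
    · exact Eventually.of_forall fun ε =>
        (Measurable.mul (by fun_prop) (by fun_prop)).aestronglyMeasurable
    · filter_upwards [Ioo_mem_nhdsGT zero_lt_one] with ε hε
      refine (ae_restrict_iff' measurableSet_Ioi).2 (Eventually.of_forall fun r hr => ?_)
      have hr' : 0 < r := hr
      have hp := Real.rpow_nonneg hr'.le (-(1 + α))
      have h := norm_one_sub_exp_neg_mul_le (z := ε + Complex.I * ξ) (by simpa using hε.1.le) hr'.le
      have hn : ‖(ε : ℂ) + Complex.I * ξ‖ ≤ 1 + |ξ| := by
        refine (norm_add_le _ _).trans ?_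
        simpa [abs_of_pos hε.1] using hε.2.le
      have hm : max 1 ‖(ε : ℂ) + Complex.I * ξ‖ ≤ 1 + |ξ| := max_le (by simp) hn
      rw [norm_mul, Complex.norm_real, Real.norm_of_nonneg hp, ← mul_assoc]
      refine mul_le_mul_of_nonneg_right (h.trans ?_) hp
      gcongr
    · refine Eventually.of_forall fun r => Tendsto.mul_const _ (Tendsto.const_sub _ ?_)
      exact (Complex.continuous_exp.tendsto _).comp (hz.mul_const _).neg
  · filter_upwards [self_mem_nhdsWithin] with ε hε
    exact (integral_one_sub_exp_neg_mul_rpow_of_re_pos hα hα1 (by simpa using hε)).symm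

lemma SchwartzMap.exists_norm_sub_le_s9 (V : SchwartzMap ℝ ℂ) :
    ∃ C, 0 ≤ C ∧ ∀ y r : ℝ, 0 ≤ r → r ≤ 1 → ‖V y - V (y - r)‖ ≤ C * r * (1 + y ^ 2)⁻¹ := by
  obtain ⟨C₀, hC₀p, hC₀⟩ := V.decay 0 1
  obtain ⟨C₂, hC₂p, hC₂⟩ := V.decay 2 1
  have hd : ∀ s, (1 + s ^ 2) * ‖deriv V s‖ ≤ C₀ + C₂ := fun s => by
    have h0 := hC₀ s
    have h2 := hC₂ s
    rw [norm_iteratedFDeriv_eq_norm_iteratedDeriv, iteratedDeriv_one] at h0 h2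
    rw [Real.norm_eq_abs, sq_abs] at h2
    linarith
  refine ⟨3 * (C₀ + C₂), by positivity, fun y r hr hr1 => ?_⟩
  have h := norm_image_sub_le_of_norm_deriv_le_segment' (f := V) (f' := deriv V) (a := y - r)
    (b := y) (C := 3 * (C₀ + C₂) * (1 + y ^ 2)⁻¹)
    (fun x _ => V.differentiableAt.hasDerivAt.hasDerivWithinAt) (fun s hs => ?_) y
    ⟨by linarith, le_rfl⟩
  · refine h.trans (le_of_eq ?_)
    ring
  · rw [← div_eq_mul_inv, le_div_iff₀ (by positivity)]
    have hsy : 1 + y ^ 2 ≤ 3 * (1 + s ^ 2) := by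
      nlinarith [hs.1, hs.2, sq_nonneg (y - 2 * s)]
    nlinarith [hd s, norm_nonneg (deriv V s)]

lemma SchwartzMap.exists_integral_norm_sub_le (V : SchwartzMap ℝ ℂ) :
    ∃ C, 0 ≤ C ∧ ∀ r : ℝ, 0 < r → ∫ y, ‖V y - V (y - r)‖ ≤ C * min 1 r := by
  obtain ⟨C, hC, h⟩ := V.exists_norm_sub_le_s9
  refine ⟨max (C * Real.pi) (2 * ∫ y, ‖V y‖), le_max_of_le_left (by positivity), fun r hr => ?_⟩
  have hi : Integrable fun y => V (y - r) := V.integrable.comp_sub_right r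
  rcases le_total r 1 with h1 | h1
  · rw [min_eq_right h1]
    calc ∫ y, ‖V y - V (y - r)‖ ≤ ∫ y : ℝ, C * r * (1 + y ^ 2)⁻¹ :=
          integral_mono (V.integrable.sub hi).norm (integrable_inv_one_add_sq.const_mul _)
            fun y => h y r hr.le h1
      _ = C * Real.pi * r := by
          rw [integral_const_mul, integral_univ_inv_one_add_sq]; ring
      _ ≤ _ := by gcongr; exact le_max_left _ _
  · rw [min_eq_left h1, mul_one]
    calc ∫ y, ‖V y - V (y - r)‖ ≤ ∫ y, (‖V y‖ + ‖V (y - r)‖) :=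
          integral_mono (V.integrable.sub hi).norm (V.integrable.norm.add hi.norm)
            fun y => norm_sub_le _ _
      _ = 2 * ∫ y, ‖V y‖ := by
          rw [integral_add V.integrable.norm hi.norm,
            integral_sub_right_eq_self (fun y => ‖V y‖) r]
          ring
      _ ≤ _ := le_max_right _ _

lemma SchwartzMap.integrable_marchaud_integrand (V : SchwartzMap ℝ ℂ) {α : ℝ} (hα : 0 < α)
    (hα1 : α < 1) (ξ : ℝ) :
    Integrable (fun p : ℝ × ℝ => (V p.1 - V (p.1 - p.2)) * ((p.2 ^ (-(1 + α)) : ℝ) : ℂ) *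
      Complex.exp (-(Complex.I * ξ * p.1))) (volume.prod (volume.restrict (Ioi 0))) := by
  have hV : Measurable V := V.continuous.measurable
  have hmeas : Measurable fun p : ℝ × ℝ => (V p.1 - V (p.1 - p.2)) *
      ((p.2 ^ (-(1 + α)) : ℝ) : ℂ) * Complex.exp (-(Complex.I * ξ * p.1)) := by fun_prop
  have hnorm : ∀ y : ℝ, ‖Complex.exp (-(Complex.I * ξ * y))‖ = 1 := fun y => by
    simp [Complex.norm_exp]
  obtain ⟨C, hC, h⟩ := V.exists_integral_norm_sub_le
  have hi : ∀ r : ℝ, Integrable fun y => V y - V (y - r) := fun r =>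
    V.integrable.sub (V.integrable.comp_sub_right r)
  rw [integrable_prod_iff' hmeas.aestronglyMeasurable]
  constructor
  · refine Eventually.of_forall fun r => ?_
    refine ((hi r).mul_const ((r ^ (-(1 + α)) : ℝ) : ℂ)).norm.mono'
      (hmeas.comp measurable_prodMk_right).aestronglyMeasurable
      (Eventually.of_forall fun y => ?_)
    rw [norm_mul, hnorm y, mul_one]
  · refine ((integrableOn_min_one_mul_rpow hα hα1).const_mul C).mono'
      hmeas.aestronglyMeasurable.norm.prod_swap.integral_prod_right' ?_
    refine (ae_restrict_iff' measurableSet_Ioi).2 (Eventually.of_forall fun r hr => ?_)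
    have hp := Real.rpow_nonneg (le_of_lt (mem_Ioi.1 hr)) (-(1 + α))
    rw [Real.norm_of_nonneg (integral_nonneg fun _ => norm_nonneg _)]
    simp only [norm_mul, hnorm, mul_one, Complex.norm_real, Real.norm_of_nonneg hp]
    rw [integral_mul_const, ← mul_assoc]
    exact mul_le_mul_of_nonneg_right (h r hr) hp

lemma SchwartzMap.integral_marchaud_mul_exp (V : SchwartzMap ℝ ℂ) {α : ℝ} (hα : 0 < α)
    (hα1 : α < 1) (ξ : ℝ) :
    ∫ y : ℝ, (∫ r in Ioi (0 : ℝ), (V y - V (y - r)) * ((r ^ (-(1 + α)) : ℝ) : ℂ)) *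
        Complex.exp (-(Complex.I * ξ * y)) =
      ((Real.Gamma (1 - α) / α : ℝ) : ℂ) * (Complex.I * ξ) ^ (α : ℂ) *
        ∫ y : ℝ, V y * Complex.exp (-(Complex.I * ξ * y)) := by
  have hi : Integrable fun y : ℝ => V y * Complex.exp (-(Complex.I * ξ * y)) := by
    refine V.integrable.norm.mono'
      (V.continuous.mul (by fun_prop)).aestronglyMeasurable (Eventually.of_forall fun y => ?_)
    simp [Complex.norm_exp]
  have hshift : ∀ r : ℝ, (fun y : ℝ => V (y - r) * Complex.exp (-(Complex.I * ξ * y))) =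
      fun y : ℝ => Complex.exp (-(Complex.I * ξ * r)) *
        (V (y - r) * Complex.exp (-(Complex.I * ξ * ((y - r : ℝ) : ℂ)))) := fun r => by
    ext y
    rw [mul_left_comm, ← Complex.exp_add]
    congr 2
    push_cast
    ring
  simp_rw [← integral_mul_const]
  rw [integral_integral_swap (V.integrable_marchaud_integrand hα hα1 ξ),
    ← integral_one_sub_exp_neg_I_mul_rpow hα hα1 ξ, ← integral_mul_const]
  refine setIntegral_congr_fun measurableSet_Ioi fun r _ => ?_
  have h1 : (fun y : ℝ => (V y - V (y - r)) * ((r ^ (-(1 + α)) : ℝ) : ℂ) *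
      Complex.exp (-(Complex.I * ξ * y))) = fun y : ℝ => ((r ^ (-(1 + α)) : ℝ) : ℂ) *
        (V y * Complex.exp (-(Complex.I * ξ * y)) -
          V (y - r) * Complex.exp (-(Complex.I * ξ * y))) := by
    ext y; ring
  have hi' : Integrable fun y : ℝ => V (y - r) * Complex.exp (-(Complex.I * ξ * y)) := by
    rw [hshift]
    exact (hi.comp_sub_right r).const_mul _
  simp only [h1]
  rw [integral_const_mul, integral_sub hi hi', hshift, integral_const_mul,
    integral_sub_right_eq_self (fun y : ℝ => V y * Complex.exp (-(Complex.I * ξ * y))) r]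
  ring

lemma setIntegral_Iio_eq_setIntegral_Ioi_sub {E : Type*} [NormedAddCommGroup E] [NormedSpace ℝ E]
    (f : ℝ → E) (y : ℝ) : ∫ s in Iio y, f s = ∫ r in Ioi (0 : ℝ), f (y - r) := by
  rw [← integral_indicator measurableSet_Iio, ← integral_indicator measurableSet_Ioi,
    ← integral_sub_left_eq_self _ volume y]
  congr 1 with r
  simp [indicator_apply]

theorem stmt_9
    (ψ ψ' ω : ℝ → ℝ)
    (hψmono : StrictMono ψ)
    (hψderiv : ∀ t, HasDerivAt ψ (ψ' t) t)
    (hψ'cont : Continuous ψ')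
    (hψ'pos : ∀ t, 0 < ψ' t)
    (hψtop : Tendsto ψ atTop atTop)
    (hψbot : Tendsto ψ atBot atBot)
    (hωmeas : Measurable ω)
    (hωpos : ∀ t, 0 < ω t)
    (hωloc : ∀ K : Set ℝ, IsCompact K → ∃ C > 0, ∀ t ∈ K, ω t ≤ C ∧ C⁻¹ ≤ ω t)
    (α : ℝ) (hα : 0 < α) (hα1 : α < 1)
    (u : ℝ → ℂ)
    (V : SchwartzMap ℝ ℂ)
    (hV : ∀ y : ℝ, V y = (ω (Function.invFun ψ y) : ℂ) * u (Function.invFun ψ y)) :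
    ∀ ξ : ℝ,
      wFT ψ ψ' ω (wD α ψ ψ' ω u) ξ =
        (Complex.I * (ξ : ℂ)) ^ (α : ℂ) * wFT ψ ψ' ω u ξ := by
  have hinj : Function.Injective ψ := hψmono.injective
  have hinv : ∀ t, Function.invFun ψ (ψ t) = t := Function.leftInverse_invFun hinj
  have hVψ : ∀ t, V (ψ t) = (ω t : ℂ) * u t := fun t => by rw [hV, hinv]
  have hψcont : Continuous ψ :=
    continuous_iff_continuousAt.2 fun t => (hψderiv t).continuousAt
  have hsurj : Function.Surjective ψ := hψcont.surjective hψtop hψbot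
  have hchange : ∀ (s : Set ℝ) (_ : MeasurableSet s) (g : ℝ → ℂ),
      ∫ t in s, g (ψ t) * (ψ' t : ℂ) = ∫ y in ψ '' s, g y := fun s hs g => by
    rw [integral_image_eq_integral_abs_deriv_smul hs
      (fun t _ => (hψderiv t).hasDerivWithinAt) hinj.injOn]
    congr 1 with t
    rw [abs_of_pos (hψ'pos t), Complex.real_smul, mul_comm]
  have himage : ∀ t, ψ '' Iio t = Iio (ψ t) := fun t => by
    ext y
    obtain ⟨s, rfl⟩ := hsurj y
    simp [hinj.mem_set_image, hψmono.lt_iff_lt]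
  have hD : ∀ t, (ω t : ℂ) * wD α ψ ψ' ω u t = ((α / Real.Gamma (1 - α) : ℝ) : ℂ) *
      ∫ r in Ioi (0 : ℝ), (V (ψ t) - V (ψ t - r)) * ((r ^ (-(1 + α)) : ℝ) : ℂ) := fun t => by
    have h := hchange (Iio t) measurableSet_Iio
      fun y => (V (ψ t) - V y) * (((ψ t - y) ^ (-(1 + α)) : ℝ) : ℂ)
    rw [himage, setIntegral_Iio_eq_setIntegral_Ioi_sub _ (ψ t)] at h
    simp only [sub_sub_cancel, hVψ] at h
    have hω : (ω t : ℂ) ≠ 0 := by exact_mod_cast (hωpos t).ne'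
    rw [wD, hVψ, ← h, Complex.ofReal_div, ← mul_assoc, mul_div_cancel₀ _ hω]
    simp only [Complex.ofReal_mul, mul_assoc]
  have hFT : ∀ (f : ℝ → ℂ) (g : ℝ → ℂ) (ξ : ℝ), (∀ t, (ω t : ℂ) * f t = g (ψ t)) →
      wFT ψ ψ' ω f ξ = (Real.sqrt (2 * Real.pi) : ℂ)⁻¹ *
        ∫ y : ℝ, g y * Complex.exp (-(Complex.I * ξ * y)) := fun f g ξ hfg => by
    have h := hchange univ MeasurableSet.univ fun y => g y * Complex.exp (-(Complex.I * ξ * y))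
    rw [image_univ, hsurj.range_eq, setIntegral_univ, setIntegral_univ] at h
    rw [wFT, ← h]
    congr 2 with t
    rw [← hfg]
    push_cast
    ring
  intro ξ
  rw [hFT _ (fun y => ((α / Real.Gamma (1 - α) : ℝ) : ℂ) *
    ∫ r in Ioi (0 : ℝ), (V y - V (y - r)) * ((r ^ (-(1 + α)) : ℝ) : ℂ)) ξ hD,
    hFT u V ξ fun t => (hVψ t).symm]
  simp only [mul_assoc ((α / Real.Gamma (1 - α) : ℝ) : ℂ)]
  rw [integral_const_mul, V.integral_marchaud_mul_exp hα hα1 ξ]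
  have hΓ : (Real.Gamma (1 - α) : ℂ) ≠ 0 := by
    exact_mod_cast (Real.Gamma_pos_of_pos (by linarith)).ne'
  have hα0 : (α : ℂ) ≠ 0 := by exact_mod_cast hα.ne'
  push_cast
  field_simp
end
end
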